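/- arXiv:1207.4856 — 2 statements merged into one kernel-verified Lean document; each statement's English description precedes it below -/
import Mathlib

section
/- CM-freeness criterion: for a Nakayama algebra with p > s, Λ is CM-free (every Gorenstein projective module is projective) if and only if every cycle in the resolution quiver contains at least one red vertex. -/
universe u

variable (Λ : Type u) [Ring Λ]

section BasicDefs

variable (M : Type u) [AddCommGroup M] [Module Λ M]

/-- A module is uniserial if its submodules are linearly ordered by inclusion. -/
def IsUniserialMod : Prop := ∀ N N' : Submodule Λ M, N ≤ N' ∨ N' ≤ N

/-- A module is indecomposable if it is nonzero and admits no nontrivial direct sum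
decomposition. -/
def IsIndecomposableMod : Prop :=
  Nontrivial M ∧ ∀ N N' : Submodule Λ M, IsCompl N N' → N = ⊥ ∨ N' = ⊥

/-- The radical of a module: the intersection of all maximal submodules. -/
def modRadical : Submodule Λ M := sInf {N : Submodule Λ M | IsCoatom N}

/-- The socle of a module: the sum of all simple submodules. -/
def modSocle : Submodule Λ M := sSup {N : Submodule Λ M | IsAtom N}

/-- `HasLength Λ M n` : the module `M` has a composition series of length `n`. -/
def HasLength (n : ℕ) : Prop :=
  ∃ c : Fin (n + 1) → Submodule Λ M,
    c 0 = ⊥ ∧ c (Fin.last n) = ⊤ ∧ ∀ i : Fin n, c i.castSucc ⋖ c i.succ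

end BasicDefs

/-- A Nakayama algebra: an artinian ring all of whose finite-length indecomposable
(left) modules are uniserial. -/
class IsNakayama : Prop where
  artinian : IsArtinianRing Λ
  serial : ∀ (M : Type u) [AddCommGroup M] [Module Λ M],
    (∃ n, HasLength Λ M n) → IsIndecomposableMod Λ M → IsUniserialMod Λ M

/-- `Λ` has no simple projective module. -/
def NoSimpleProjectives : Prop :=
  ∀ (M : Type u) [AddCommGroup M] [Module Λ M], IsSimpleModule Λ M → ¬ Module.Projective Λ M

/-- `Λ` is connected: no nontrivial central idempotents. -/
def IsConnectedAlg : Prop :=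
  ∀ e : Λ, IsIdempotentElem e → (∀ x : Λ, e * x = x * e) → e = 0 ∨ e = 1

section Covers

variable {Λ}
variable {P M : Type u} [AddCommGroup P] [Module Λ P] [AddCommGroup M] [Module Λ M]

/-- `p : P → M` is a projective cover: `P` projective, `p` surjective with superfluous
kernel. -/
structure IsProjCover (p : P →ₗ[Λ] M) : Prop where
  projective : Module.Projective Λ P
  surjective : Function.Surjective p
  superfluous : LinearMap.ker p ≤ modRadical Λ P

end Covers

/-- `S` is (isomorphic to) the top `M/rad M` of `M`, and is simple. -/
def IsTopOf (S M : Type u) [AddCommGroup S] [Module Λ S] [AddCommGroup M] [Module Λ M] :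
    Prop :=
  IsSimpleModule Λ S ∧
    ∃ p : M →ₗ[Λ] S, Function.Surjective p ∧ LinearMap.ker p = modRadical Λ M

/-- `S` is (isomorphic to) the socle of `M`. -/
def IsSocleOf (S M : Type u) [AddCommGroup S] [Module Λ S] [AddCommGroup M] [Module Λ M] :
    Prop :=
  ∃ i : S →ₗ[Λ] M, Function.Injective i ∧ LinearMap.range i = modSocle Λ M

/-- `IsTauOf Λ T S` : `T` is the Auslander–Reiten translate `τ S` of the simple module `S`;
for a Nakayama algebra without simple projectives this means there is a length-2 module
with top `S` and socle `T`. -/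
def IsTauOf (T S : Type u) [AddCommGroup T] [Module Λ T] [AddCommGroup S] [Module Λ S] :
    Prop :=
  IsSimpleModule Λ S ∧ IsSimpleModule Λ T ∧
    ∃ L : ModuleCat.{u} Λ, HasLength Λ L 2 ∧ IsTopOf Λ S L ∧ IsSocleOf Λ T L

/-- `GammaRel Λ S T` : `T = γ S = τ soc P(S)` in the resolution quiver. -/
def GammaRel (S T : Type u) [AddCommGroup S] [Module Λ S] [AddCommGroup T] [Module Λ T] :
    Prop :=
  IsSimpleModule Λ S ∧
    ∃ (P : ModuleCat.{u} Λ) (p : P →ₗ[Λ] S), IsProjCover p ∧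
      ∃ V : ModuleCat.{u} Λ, IsSimpleModule Λ V ∧ IsSocleOf Λ V P ∧ IsTauOf Λ T V

/-- A simple module is black if its projective dimension is at least 2, i.e. the kernel of
its projective cover is not projective. -/
def IsBlackSimple (S : Type u) [AddCommGroup S] [Module Λ S] : Prop :=
  IsSimpleModule Λ S ∧
    ∀ (P : ModuleCat.{u} Λ) (p : P →ₗ[Λ] S), IsProjCover p →
      ¬ Module.Projective Λ (LinearMap.ker p)

/-- A simple module is red if it has projective dimension exactly 1, i.e. the kernel of its
projective cover is projective. -/
def IsRedSimple (S : Type u) [AddCommGroup S] [Module Λ S] : Prop :=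
  IsSimpleModule Λ S ∧
    ∃ (P : ModuleCat.{u} Λ) (p : P →ₗ[Λ] S), IsProjCover p ∧
      Module.Projective Λ (LinearMap.ker p)

/-- A simple module is cyclically black if it lies on a cycle of the resolution quiver all
of whose vertices are black. -/
def IsCyclicallyBlack (S : Type u) [AddCommGroup S] [Module Λ S] : Prop :=
  ∃ (n : ℕ) (C : ℕ → ModuleCat.{u} Λ), 0 < n ∧
    Nonempty ((C 0 : Type u) ≃ₗ[Λ] S) ∧ Nonempty ((C n : Type u) ≃ₗ[Λ] S) ∧
    (∀ i < n, GammaRel Λ (C i) (C (i + 1))) ∧ ∀ i ≤ n, IsBlackSimple Λ (C i)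

/-- An indecomposable projective module is minimal projective if its radical is not
projective. -/
def IsMinimalProjective (P : Type u) [AddCommGroup P] [Module Λ P] : Prop :=
  Module.Projective Λ P ∧ IsIndecomposableMod Λ P ∧
    ¬ Module.Projective Λ (modRadical Λ P)

/-- `M` is Gorenstein projective: it is an image in a complete projective resolution, i.e.
an exact complex of projectives which stays exact after applying `Hom(-, Λ)`. -/
def IsGorensteinProjective (M : Type u) [AddCommGroup M] [Module Λ M] : Prop :=
  ∃ (P : ℤ → ModuleCat.{u} Λ) (d : ∀ i, P (i + 1) →ₗ[Λ] P i),
    (∀ i, Module.Projective Λ (P i)) ∧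
    (∀ i, Function.Exact (d (i + 1)) (d i)) ∧
    (∀ (i : ℤ) (φ : P (i + 1) →ₗ[Λ] Λ), φ.comp (d (i + 1)) = 0 →
      ∃ ψ : P i →ₗ[Λ] Λ, ψ.comp (d i) = φ) ∧
    Nonempty (M ≃ₗ[Λ] LinearMap.range (d 0))

/-- `M` has a finite projective resolution. -/
def HasFinitePD (M : Type u) [AddCommGroup M] [Module Λ M] : Prop :=
  ∃ (n : ℕ) (P : ℕ → ModuleCat.{u} Λ) (d : ∀ i, P (i + 1) →ₗ[Λ] P i)
      (ε : P 0 →ₗ[Λ] M),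
    (∀ i, Module.Projective Λ (P i)) ∧ Function.Surjective ε ∧
    Function.Exact (d 0) ε ∧ (∀ i, Function.Exact (d (i + 1)) (d i)) ∧
    ∀ i, n < i → Subsingleton (P i)

/-- `M` has injective dimension at most `n` (over the ring `Λ`). -/
def InjDimLE (M : Type u) [AddCommGroup M] [Module Λ M] (n : ℕ) : Prop :=
  ∃ (I : ℕ → ModuleCat.{u} Λ) (η : M →ₗ[Λ] I 0) (d : ∀ i, I i →ₗ[Λ] I (i + 1)),
    (∀ i, Module.Injective Λ (I i)) ∧ Function.Injective η ∧
    Function.Exact η (d 0) ∧ (∀ i, Function.Exact (d i) (d (i + 1))) ∧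
    ∀ i, n < i → Subsingleton (I i)

/-- `Λ` is a Gorenstein algebra: finite injective dimension as a left and right module
over itself. -/
def IsGorensteinAlg : Prop :=
  (∃ n, InjDimLE Λ Λ n) ∧ ∃ n, InjDimLE Λᵐᵒᵖ Λ n

/-- Every cycle of the resolution quiver consists of black vertices. -/
def AllCyclesBlack : Prop :=
  ∀ (n : ℕ) (C : ℕ → ModuleCat.{u} Λ), 0 < n →
    (∀ i < n, GammaRel Λ (C i) (C (i + 1))) →
    Nonempty ((C n : Type u) ≃ₗ[Λ] (C 0 : Type u)) →
    ∀ i ≤ n, IsBlackSimple Λ (C i)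

/-- Every cycle of the resolution quiver contains a red vertex. -/
def EveryCycleHasRed : Prop :=
  ∀ (n : ℕ) (C : ℕ → ModuleCat.{u} Λ), 0 < n →
    (∀ i < n, GammaRel Λ (C i) (C (i + 1))) →
    Nonempty ((C n : Type u) ≃ₗ[Λ] (C 0 : Type u)) →
    ∃ i ≤ n, IsRedSimple Λ (C i)

/-- `Λ` is CM-free: every finite-length Gorenstein projective module is projective. -/
def IsCMFree : Prop :=
  ∀ (M : Type u) [AddCommGroup M] [Module Λ M],
    (∃ n, HasLength Λ M n) → IsGorensteinProjective Λ M → Module.Projective Λ M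

/-- `Λ` has exactly `s` isomorphism classes of simple modules. -/
def SimpleCount (s : ℕ) : Prop :=
  ∃ F : Fin s → ModuleCat.{u} Λ,
    (∀ i, IsSimpleModule Λ (F i)) ∧
    (∀ i j, i ≠ j → IsEmpty ((F i : Type u) ≃ₗ[Λ] (F j : Type u))) ∧
    ∀ (S : Type u) [AddCommGroup S] [Module Λ S], IsSimpleModule Λ S →
      ∃ i, Nonempty (S ≃ₗ[Λ] (F i : Type u))

/-- Every (finite length) indecomposable projective module has length `> s`;
this is the condition `p > s`. -/
def MinProjLengthGT (s : ℕ) : Prop :=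
  ∀ (P : Type u) [AddCommGroup P] [Module Λ P],
    Module.Projective Λ P → IsIndecomposableMod Λ P →
      ∀ n, HasLength Λ P n → s < n

/-- An elementary Gorenstein projective module: nonzero, Gorenstein projective,
non-projective, and no proper nonzero factor module is Gorenstein projective. -/
def IsElementary (E : Type u) [AddCommGroup E] [Module Λ E] : Prop :=
  Nontrivial E ∧ (∃ n, HasLength Λ E n) ∧ IsGorensteinProjective Λ E ∧
    ¬ Module.Projective Λ E ∧
    ∀ N : Submodule Λ E, N ≠ ⊥ → N ≠ ⊤ → ¬ IsGorensteinProjective Λ (E ⧸ N)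

/-- `m` is the multiplicity of the simple module `S` as a composition factor of `M`. -/
def MultiplicityOf (S M : Type u) [AddCommGroup S] [Module Λ S] [AddCommGroup M]
    [Module Λ M] (m : ℕ) : Prop :=
  ∃ (n : ℕ) (c : Fin (n + 1) → Submodule Λ M),
    c 0 = ⊥ ∧ c (Fin.last n) = ⊤ ∧ (∀ i : Fin n, c i.castSucc ⋖ c i.succ) ∧
    m = Nat.card {i : Fin n //
      Nonempty ((↥(c i.succ) ⧸ (c i.castSucc).comap (c i.succ).subtype) ≃ₗ[Λ] S)}

/-- From `S`, the cycles of the resolution quiver can be reached (in a black-cycle vertex)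
in `m` steps. -/
def ReachesBlackIn (S : Type u) [AddCommGroup S] [Module Λ S] (m : ℕ) : Prop :=
  ∃ C : ℕ → ModuleCat.{u} Λ, Nonempty ((C 0 : Type u) ≃ₗ[Λ] S) ∧
    (∀ i < m, GammaRel Λ (C i) (C (i + 1))) ∧ IsCyclicallyBlack Λ (C m)

/-- `d` is the maximal distance of a vertex of the resolution quiver to the black cycles. -/
def MaxDistToBlack (d : ℕ) : Prop :=
  (∀ (S : Type u) [AddCommGroup S] [Module Λ S], IsSimpleModule Λ S →
      ∃ m ≤ d, ReachesBlackIn Λ S m) ∧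
  ∃ S : ModuleCat.{u} Λ, IsSimpleModule Λ S ∧ ∀ m < d, ¬ ReachesBlackIn Λ (S : Type u) m


section Aux1

instance isArtinianRing_of_isNakayama [h : IsNakayama Λ] : IsArtinianRing Λ := h.artinian

/-- Nonzero uniserial finitely generated module. -/
structure IsU (M : Type u) [AddCommGroup M] [Module Λ M] : Prop where
  nt : Nontrivial M
  us : IsUniserialMod Λ M
  fin : Module.Finite Λ M

/-- natural number length -/
noncomputable def ell (M : Type u) [AddCommGroup M] [Module Λ M] : ℕ := (Module.length Λ M).toNat

variable {Λ}
variable {M N X : Type u} [AddCommGroup M] [Module Λ M] [AddCommGroup N] [Module Λ N]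
  [AddCommGroup X] [Module Λ X]

theorem hasLength_imp {n : ℕ} (h : HasLength Λ M n) :
    Module.Finite Λ M ∧ Module.length Λ M = n := by
  obtain ⟨c, h0, h1, h2⟩ := h
  let s : CompositionSeries (Submodule Λ M) := ⟨n, c, h2⟩
  have hh : s.head = ⊥ := h0
  have hl : s.last = ⊤ := h1
  have hf := isFiniteLength_of_exists_compositionSeries ⟨s, hh, hl⟩
  have := (isFiniteLength_iff_isNoetherian_isArtinian.mp hf).1
  exact ⟨inferInstance, (Module.length_compositionSeries s hh hl).symm⟩

theorem length_coe [IsArtinianRing Λ] [Module.Finite Λ M] :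
    Module.length Λ M = (ell Λ M : ℕ∞) := by
  have : IsNoetherian Λ M := inferInstance
  have : IsArtinian Λ M := inferInstance
  exact (ENat.natCast_toNat Module.length_ne_top).symm

theorem hasLength_of [IsArtinianRing Λ] [Module.Finite Λ M] : HasLength Λ M (ell Λ M) := by
  have : IsNoetherian Λ M := inferInstance
  have : IsArtinian Λ M := inferInstance
  obtain ⟨s, hs, hs'⟩ := exists_compositionSeries_of_isNoetherian_isArtinian Λ M
  have h := Module.length_compositionSeries s hs hs'
  rw [length_coe] at h
  have h' : s.length = ell Λ M := by exact_mod_cast h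
  rw [← h']
  exact ⟨s.toFun, hs, hs', s.step⟩

theorem ell_congr (e : M ≃ₗ[Λ] N) : ell Λ M = ell Λ N := by
  unfold ell; rw [e.length_eq]

theorem ell_add [IsArtinianRing Λ] [Module.Finite Λ M] (K : Submodule Λ M) :
    ell Λ M = ell Λ K + ell Λ (M ⧸ K) := by
  have : IsNoetherian Λ M := inferInstance
  have h := Module.length_eq_add_of_exact K.subtype K.mkQ K.subtype_injective K.mkQ_surjective
    (LinearMap.exact_subtype_mkQ K)
  rw [length_coe, length_coe, length_coe] at h
  exact_mod_cast h

theorem ell_pos [IsArtinianRing Λ] [Module.Finite Λ M] [Nontrivial M] : 0 < ell Λ M := by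
  have h := Module.length_pos (R := Λ) (M := M)
  rw [length_coe] at h
  exact_mod_cast h

theorem ell_eq_one_iff [IsArtinianRing Λ] [Module.Finite Λ M] :
    ell Λ M = 1 ↔ IsSimpleModule Λ M := by
  rw [← Module.length_eq_one_iff, length_coe]
  norm_cast

theorem ell_lt [IsArtinianRing Λ] [Module.Finite Λ M] {K : Submodule Λ M} (h : K ≠ ⊤) :
    ell Λ K < ell Λ M := by
  have : Nontrivial (M ⧸ K) := Submodule.Quotient.nontrivial_iff.mpr h
  have := ell_add K
  have := ell_pos (Λ := Λ) (M := M ⧸ K)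
  omega

theorem ell_range_add_ker [IsArtinianRing Λ] [Module.Finite Λ M] (f : M →ₗ[Λ] N) :
    ell Λ M = ell Λ (LinearMap.ker f) + ell Λ (LinearMap.range f) := by
  rw [ell_add (LinearMap.ker f), ell_congr f.quotKerEquivRange]

theorem IsU.of_surjective (h : IsU Λ M) [Nontrivial N] (f : M →ₗ[Λ] N)
    (hf : Function.Surjective f) : IsU Λ N := by
  refine ⟨inferInstance, fun A B => ?_, ?_⟩
  · rcases h.us (A.comap f) (B.comap f) with h | h
    · exact Or.inl ((Submodule.comap_le_comap_iff_of_surjective hf).mp h)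
    · exact Or.inr ((Submodule.comap_le_comap_iff_of_surjective hf).mp h)
  · have := h.fin
    exact Module.Finite.of_surjective f hf

theorem IsU.of_injective [IsArtinianRing Λ] (h : IsU Λ M) [Nontrivial N] (f : N →ₗ[Λ] M)
    (hf : Function.Injective f) : IsU Λ N := by
  have := h.fin
  refine ⟨inferInstance, fun A B => ?_, ?_⟩
  · rcases h.us (A.map f) (B.map f) with h | h
    · exact Or.inl ((Submodule.map_le_map_iff_of_injective hf _ _).mp h)
    · exact Or.inr ((Submodule.map_le_map_iff_of_injective hf _ _).mp h)
  · exact Module.Finite.of_injective f hf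

theorem IsU.sub [IsArtinianRing Λ] (h : IsU Λ M) {K : Submodule Λ M} (hK : K ≠ ⊥) :
    IsU Λ K := by
  have : Nontrivial K := (Submodule.nontrivial_iff_ne_bot).mpr hK
  exact h.of_injective K.subtype K.subtype_injective

theorem IsU.quot (h : IsU Λ M) {K : Submodule Λ M} (hK : K ≠ ⊤) :
    IsU Λ (M ⧸ K) := by
  have : Nontrivial (M ⧸ K) := Submodule.Quotient.nontrivial_iff.mpr hK
  exact h.of_surjective K.mkQ K.mkQ_surjective

theorem IsU.congr (h : IsU Λ M) (e : M ≃ₗ[Λ] N) : IsU Λ N := by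
  have := h.nt
  have : Nontrivial N := e.symm.toEquiv.nontrivial
  exact h.of_surjective e.toLinearMap e.surjective

theorem IsU.indec (h : IsU Λ M) : IsIndecomposableMod Λ M := by
  refine ⟨h.nt, fun A B hAB => ?_⟩
  rcases h.us A B with h | h
  · left; exact hAB.disjoint.eq_bot_of_le h
  · right; exact hAB.disjoint.symm.eq_bot_of_le h

theorem isU_of_indec [IsNakayama Λ] [Module.Finite Λ M] (h : IsIndecomposableMod Λ M) :
    IsU Λ M :=
  ⟨h.1, IsNakayama.serial M ⟨_, hasLength_of⟩ h, inferInstance⟩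

theorem IsU.coatom_unique (h : IsU Λ M) {A B : Submodule Λ M} (hA : IsCoatom A)
    (hB : IsCoatom B) : A = B := by
  rcases h.us A B with h | h
  · exact (hA.le_iff_eq hB.1).mp h |>.symm
  · exact (hB.le_iff_eq hA.1).mp h

theorem IsU.le_coatom (h : IsU Λ M) {A B : Submodule Λ M} (hA : IsCoatom A)
    (hB : B ≠ ⊤) : B ≤ A := by
  rcases h.us A B with h | h
  · exact ((hA.le_iff_eq hB).mp h).le
  · exact h

theorem IsU.atom_le (h : IsU Λ M) {A B : Submodule Λ M} (hA : IsAtom A)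
    (hB : B ≠ ⊥) : A ≤ B := by
  rcases h.us A B with h | h
  · exact h
  · exact ((hA.le_iff_eq hB).mp h).ge

theorem IsU.radical (h : IsU Λ M) {A : Submodule Λ M} (hA : IsCoatom A) :
    modRadical Λ M = A := by
  apply le_antisymm
  · exact sInf_le hA
  · exact le_sInf fun B hB => (h.coatom_unique hA hB).le

theorem IsU.socle (h : IsU Λ M) {A : Submodule Λ M} (hA : IsAtom A) :
    modSocle Λ M = A := by
  apply le_antisymm
  · exact sSup_le fun B hB => h.atom_le hB hA.1
  · exact le_sSup hA

theorem isCoatom_ker_of_surjective [IsSimpleModule Λ N] (f : M →ₗ[Λ] N)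
    (hf : Function.Surjective f) : IsCoatom (LinearMap.ker f) := by
  rw [← isSimpleModule_iff_isCoatom]
  exact IsSimpleModule.congr (f.quotKerEquivOfSurjective hf)

/-- a map into a uniserial module which is nonzero on the top is surjective. -/
theorem IsU.surjective_of_comp [IsSimpleModule Λ X] (h : IsU Λ N) (f : M →ₗ[Λ] N)
    (g : N →ₗ[Λ] X) (hg : Function.Surjective (g.comp f)) : Function.Surjective f := by
  have hg' : Function.Surjective g := by
    intro x
    obtain ⟨y, hy⟩ := hg x
    exact ⟨f y, hy⟩
  have hc := isCoatom_ker_of_surjective g hg'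
  by_contra hcon
  rw [← LinearMap.range_eq_top] at hcon
  have := h.le_coatom hc hcon
  have hz : g.comp f = 0 := LinearMap.range_le_ker_iff.mp this
  rw [hz] at hg
  have hnt := IsSimpleModule.nontrivial Λ X
  obtain ⟨x, hx⟩ := exists_ne (0 : X)
  obtain ⟨y, hy⟩ := hg x
  exact hx hy.symm

theorem IsU.exists_socle_elt [IsArtinianRing Λ] (h : IsU Λ M) :
    ∃ y : M, y ≠ 0 ∧ ∀ K : Submodule Λ M, K ≠ ⊥ → y ∈ K := by
  have := h.fin
  have := h.nt
  obtain ⟨A, hA, -⟩ := (eq_bot_or_exists_atom_le (⊤ : Submodule Λ M)).resolve_left top_ne_bot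
  obtain ⟨y, hy, hy0⟩ := (Submodule.ne_bot_iff A).mp hA.1
  exact ⟨y, hy0, fun K hK => h.atom_le hA hK hy⟩

/-- uniserial projective quotient. -/
theorem IsU.injective_of_split (h : IsU Λ M) [Nontrivial N] [Module.Projective Λ N]
    (f : M →ₗ[Λ] N) (hf : Function.Surjective f) : Function.Injective f := by
  obtain ⟨g, hg⟩ := Module.projective_lifting_property f LinearMap.id hf
  rw [← LinearMap.ker_eq_bot]
  rcases h.us (LinearMap.ker f) (LinearMap.range g) with h | h
  · rw [eq_bot_iff]
    intro x hx
    obtain ⟨y, rfl⟩ := h hx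
    have : y = 0 := by
      have := LinearMap.congr_fun hg y
      simpa [LinearMap.mem_ker.mp hx] using this.symm
    simp [this]
  · exfalso
    obtain ⟨y, hy⟩ := exists_ne (0 : N)
    apply hy
    have := LinearMap.congr_fun hg y
    have h2 := h ⟨y, rfl⟩
    simpa [LinearMap.mem_ker.mp h2] using this.symm

/-- projection to an indecomposable summand not killing an element. -/
theorem exists_summand [IsNakayama Λ] [Module.Finite Λ M] (y : M) (hy : y ≠ 0) :
    ∃ (Q : Submodule Λ M) (π : M →ₗ[Λ] Q), π.comp Q.subtype = LinearMap.id ∧ IsU Λ Q ∧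
      π y ≠ 0 := by
  have hwf : WellFoundedGT (Submodule Λ M) := inferInstance
  let S : Set (Submodule Λ M) := {C | (∃ D, IsCompl C D) ∧ y ∉ C}
  obtain ⟨C, ⟨⟨D, hCD⟩, hyC⟩, hmax⟩ := hwf.wf.has_min S
    ⟨⊥, ⟨⊤, isCompl_bot_top⟩, by simpa using hy⟩
  refine ⟨D, Submodule.projectionOnto D C hCD.symm, ?_, ?_, ?_⟩
  · ext x; simp
  · apply isU_of_indec
    refine ⟨?_, fun A B hAB => ?_⟩
    · rw [Submodule.nontrivial_iff_ne_bot]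
      rintro rfl
      apply hyC
      have := hCD.sup_eq_top
      rw [sup_bot_eq] at this
      simp [this]
    · by_contra hcon
      push Not at hcon
      set A' := A.map D.subtype with hA'
      set B' := B.map D.subtype with hB'
      have hAB1 : A' ⊔ B' = D := by
        rw [hA', hB', ← Submodule.map_sup, hAB.sup_eq_top, Submodule.map_subtype_top]
      have hAB2 : A' ⊓ B' = ⊥ := by
        rw [hA', hB', ← Submodule.map_inf _ D.subtype_injective, hAB.inf_eq_bot, Submodule.map_bot]
      have hdis : ∀ a ∈ A', ∀ b ∈ B', ∀ c ∈ C, a + b + c = 0 → a = 0 ∧ b = 0 ∧ c = 0 := by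
        intro a ha b hb c hc h
        have hD : a + b ∈ D := by rw [← hAB1]; exact Submodule.add_mem_sup ha hb
        have hc0 : c = 0 := by
          have : c ∈ C ⊓ D := ⟨hc, by
            have : c = -(a + b) := by rw [eq_neg_iff_add_eq_zero, add_comm]; exact h
            rw [this]; exact D.neg_mem hD⟩
          rw [hCD.inf_eq_bot] at this; simpa using this
        subst hc0
        have ha0 : a = 0 := by
          have : a ∈ A' ⊓ B' := ⟨ha, by
            have : a = -b := by rw [eq_neg_iff_add_eq_zero]; simpa using h
            rw [this]; exact B'.neg_mem hb⟩
          rw [hAB2] at this; simpa using this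
        subst ha0
        exact ⟨rfl, by simpa using h, rfl⟩
      have key : ∀ A B : Submodule Λ M, A ≠ ⊥ → A ⊔ B = D →
          (∀ a ∈ A, ∀ b ∈ B, ∀ c ∈ C, a + b + c = 0 → a = 0 ∧ b = 0 ∧ c = 0) → y ∈ C ⊔ A := by
        intro A B hA hAB hd
        by_contra hy'
        refine hmax (C ⊔ A) ⟨⟨B, ?_, ?_⟩, hy'⟩ ?_
        · rw [Submodule.disjoint_def]
          intro x hx hxB
          obtain ⟨c, hc, a, ha, rfl⟩ := Submodule.mem_sup.mp hx
          have := hd a ha (-(c + a)) (B.neg_mem hxB) c hc (by abel)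
          simp [this.1, this.2.2]
        · rw [codisjoint_iff, sup_assoc, hAB, hCD.sup_eq_top]
        · refine lt_of_le_of_ne le_sup_left fun h => hA ?_
          rw [eq_bot_iff]
          intro a ha
          have haC : a ∈ C := by rw [h]; exact Submodule.mem_sup_right ha
          have := hd a ha 0 B.zero_mem (-a) (C.neg_mem haC) (by abel)
          simp [this.1]
      have hne : ∀ E : Submodule Λ D, E ≠ ⊥ → E.map D.subtype ≠ ⊥ := by
        intro E hE h
        apply hE
        apply Submodule.map_injective_of_injective D.subtype_injective
        rw [h, Submodule.map_bot]
      have h1 := key A' B' (hne A hcon.1) hAB1 hdis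
      have h2 := key B' A' (hne B hcon.2) (by rw [sup_comm]; exact hAB1)
        (fun b hb a ha c hc h => by
          have := hdis a ha b hb c hc (by rw [add_comm a b]; exact h)
          exact ⟨this.2.1, this.1, this.2.2⟩)
      obtain ⟨c, hc, a, ha, hca⟩ := Submodule.mem_sup.mp h1
      obtain ⟨c', hc', b, hb, hcb⟩ := Submodule.mem_sup.mp h2
      have h3 := hdis a ha (-b) (B'.neg_mem hb) (c - c') (C.sub_mem hc hc') (by
        have : c + a = c' + b := hca.trans hcb.symm
        have h4 : a + -b + (c - c') = (c + a) - (c' + b) := by abel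
        rw [h4, this, sub_self])
      apply hyC
      rw [← hca, h3.1, add_zero]
      exact hc
  · intro h
    apply hyC
    simpa using h

end Aux1

section Aux2

variable {Λ}

theorem exists_min_summand [IsNakayama Λ] {M : Type u} [AddCommGroup M] [Module Λ M]
    [Module.Finite Λ M] (p : Submodule Λ M → Prop) (htop : p ⊤) (hbot : ¬ p ⊥)
    (hsup : ∀ A B, Disjoint A B → p (A ⊔ B) → p A ∨ p B) :
    ∃ (Q : Submodule Λ M) (π : M →ₗ[Λ] Q), π.comp Q.subtype = LinearMap.id ∧ IsU Λ Q ∧ p Q := by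
  have hwf : WellFoundedLT (Submodule Λ M) := inferInstance
  let S : Set (Submodule Λ M) := {D | (∃ C, IsCompl D C) ∧ p D}
  obtain ⟨D, ⟨⟨C, hDC⟩, hpD⟩, hmin⟩ := hwf.wf.has_min S ⟨⊤, ⟨⊥, isCompl_top_bot⟩, htop⟩
  refine ⟨D, Submodule.projectionOnto D C hDC, by ext x; simp, ?_, hpD⟩
  apply isU_of_indec
  refine ⟨?_, fun A B hAB => ?_⟩
  · rw [Submodule.nontrivial_iff_ne_bot]
    rintro rfl
    exact hbot hpD
  · by_contra hcon
    push Not at hcon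
    set A' := A.map D.subtype with hA'
    set B' := B.map D.subtype with hB'
    have hAB1 : A' ⊔ B' = D := by
      rw [hA', hB', ← Submodule.map_sup, hAB.sup_eq_top, Submodule.map_subtype_top]
    have hAB2 : A' ⊓ B' = ⊥ := by
      rw [hA', hB', ← Submodule.map_inf _ D.subtype_injective, hAB.inf_eq_bot, Submodule.map_bot]
    have hne : ∀ E : Submodule Λ D, E ≠ ⊥ → E.map D.subtype ≠ ⊥ := by
      intro E hE h
      apply hE
      apply Submodule.map_injective_of_injective D.subtype_injective
      rw [h, Submodule.map_bot]
    have key : ∀ A B : Submodule Λ M, B ≠ ⊥ → A ⊔ B = D → A ⊓ B = ⊥ → ¬ p A := by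
      intro A B hB hs hi hpA
      refine hmin A ⟨⟨B ⊔ C, ?_, ?_⟩, hpA⟩ ?_
      · apply Disjoint.disjoint_sup_right_of_disjoint_sup_left
        · exact disjoint_iff.mpr hi
        · rw [hs]; exact hDC.disjoint
      · rw [codisjoint_iff, ← sup_assoc, hs, hDC.sup_eq_top]
      · refine lt_of_le_of_ne (hs ▸ le_sup_left) ?_
        rintro rfl
        apply hB
        rw [sup_eq_left] at hs
        rw [inf_eq_right.mpr hs] at hi
        exact hi
    rw [← hAB1] at hpD
    rcases hsup A' B' (disjoint_iff.mpr hAB2) hpD with h | h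
    · exact key A' B' (hne B hcon.2) hAB1 hAB2 h
    · exact key B' A' (hne A hcon.1) (by rw [sup_comm, hAB1]) (by rw [inf_comm, hAB2]) h

variable (Λ) in
/-- All the data of chosen simples, projective covers, and the translation. -/
structure Setup (s : ℕ) where
  F : Fin s → ModuleCat.{u} Λ
  simple : ∀ i, IsSimpleModule Λ (F i)
  inj : ∀ i j, Nonempty ((F i : Type u) ≃ₗ[Λ] (F j : Type u)) → i = j
  surj : ∀ (S : Type u) [AddCommGroup S] [Module Λ S], IsSimpleModule Λ S →
      ∃ i, Nonempty (S ≃ₗ[Λ] (F i : Type u))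
  P : Fin s → Submodule Λ Λ
  r : ∀ i, Λ →ₗ[Λ] P i
  hr : ∀ i, (r i).comp (P i).subtype = LinearMap.id
  U : ∀ i, IsU Λ (P i)
  π : ∀ i, P i →ₗ[Λ] (F i : Type u)
  hπ : ∀ i, Function.Surjective (π i)
  hne : ∀ i, LinearMap.ker (π i) ≠ ⊥
  τ : Fin s → Fin s
  hτ : ∀ i, ∃ f : LinearMap.ker (π i) →ₗ[Λ] (F (τ i) : Type u), Function.Surjective f

theorem exists_top_aux [IsArtinianRing Λ] {s : ℕ} {F : Fin s → ModuleCat.{u} Λ}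
    (surj : ∀ (S : Type u) [AddCommGroup S] [Module Λ S], IsSimpleModule Λ S →
      ∃ i, Nonempty (S ≃ₗ[Λ] (F i : Type u)))
    {M : Type u} [AddCommGroup M] [Module Λ M] [Nontrivial M] [Module.Finite Λ M] :
    ∃ i, ∃ f : M →ₗ[Λ] (F i : Type u), Function.Surjective f := by
  obtain ⟨A, hA, -⟩ := (eq_top_or_exists_le_coatom (⊥ : Submodule Λ M)).resolve_left bot_ne_top
  obtain ⟨i, ⟨e⟩⟩ := surj (M ⧸ A) (isSimpleModule_iff_isCoatom.mpr hA)
  exact ⟨i, e.toLinearMap.comp A.mkQ, e.surjective.comp A.mkQ_surjective⟩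

theorem exists_setup [IsNakayama Λ] (h0 : NoSimpleProjectives Λ)
    (s : ℕ) (hs : SimpleCount Λ s) : Nonempty (Setup Λ s) := by
  obtain ⟨F, simple, inj, surj⟩ := hs
  have H : ∀ i, ∃ (Q : Submodule Λ Λ) (r : Λ →ₗ[Λ] Q), r.comp Q.subtype = LinearMap.id ∧
      IsU Λ Q ∧ ∃ π : Q →ₗ[Λ] (F i : Type u), Function.Surjective π := by
    intro i
    have := simple i
    have hnt := IsSimpleModule.nontrivial Λ (F i)
    obtain ⟨x, hx⟩ := exists_ne (0 : F i)
    let f : Λ →ₗ[Λ] (F i : Type u) := LinearMap.toSpanSingleton Λ _ x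
    have hf : f 1 ≠ 0 := by simpa [f] using hx
    obtain ⟨Q, r, hr, hU, hp⟩ := exists_min_summand (fun Q : Submodule Λ Λ => ¬ Q ≤ LinearMap.ker f)
      (fun h => hf (h (Submodule.mem_top (x := 1)))) (by simp) (by
        intro A B _ h
        by_contra hcon
        push Not at hcon
        exact h (sup_le hcon.1 hcon.2))
    refine ⟨Q, r, hr, hU, f.comp Q.subtype, ?_⟩
    apply LinearMap.surjective_of_ne_zero
    intro h
    apply hp
    intro x hx
    exact LinearMap.congr_fun h ⟨x, hx⟩
  choose P r hr U π hπ using H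
  have hne : ∀ i, LinearMap.ker (π i) ≠ ⊥ := by
    intro i h
    have := simple i
    apply h0 (F i) (simple i)
    have hp : Module.Projective Λ (P i) := Module.Projective.of_split (P i).subtype (r i) (hr i)
    exact Module.Projective.of_equiv (LinearEquiv.ofBijective (π i) ⟨LinearMap.ker_eq_bot.mp h, hπ i⟩)
  have H2 : ∀ i, ∃ j, ∃ f : LinearMap.ker (π i) →ₗ[Λ] (F j : Type u), Function.Surjective f := by
    intro i
    have := (U i).fin
    have : Nontrivial (LinearMap.ker (π i)) := Submodule.nontrivial_iff_ne_bot.mpr (hne i)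
    exact exists_top_aux surj
  choose τ hτ using H2
  refine ⟨⟨F, simple, ?_, surj, P, r, hr, U, π, hπ, hne, τ, hτ⟩⟩
  intro i j ⟨e⟩
  by_contra h
  exact (inj i j h).false e

namespace Setup

variable {s : ℕ} (D : Setup Λ s)
variable {M N X : Type u} [AddCommGroup M] [Module Λ M] [AddCommGroup N] [Module Λ N]
  [AddCommGroup X] [Module Λ X]

/-- `F i` is a quotient of `M`. -/
def Top (M : Type u) [AddCommGroup M] [Module Λ M] (i : Fin s) : Prop :=
  ∃ f : M →ₗ[Λ] (D.F i : Type u), Function.Surjective f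

/-- length of the `i`-th projective -/
noncomputable def c (i : Fin s) : ℕ := ell Λ (D.P i)

theorem proj (i : Fin s) : Module.Projective Λ (D.P i) :=
  Module.Projective.of_split (D.P i).subtype (D.r i) (D.hr i)

theorem exists_top [IsArtinianRing Λ] (h : IsU Λ M) : ∃ i, D.Top M i := by
  have := h.nt
  have := h.fin
  exact exists_top_aux D.surj

theorem top_unique (h : IsU Λ M) {i j : Fin s} (hi : D.Top M i) (hj : D.Top M j) : i = j := by
  obtain ⟨f, hf⟩ := hi
  obtain ⟨g, hg⟩ := hj
  have := D.simple i
  have := D.simple j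
  have e := h.coatom_unique (isCoatom_ker_of_surjective f hf) (isCoatom_ker_of_surjective g hg)
  apply D.inj
  exact ⟨(f.quotKerEquivOfSurjective hf).symm ≪≫ₗ Submodule.quotEquivOfEq _ _ e ≪≫ₗ
    g.quotKerEquivOfSurjective hg⟩

theorem top_of_surj (f : M →ₗ[Λ] N) (hf : Function.Surjective f) {i : Fin s}
    (h : D.Top N i) : D.Top M i := by
  obtain ⟨g, hg⟩ := h
  exact ⟨g.comp f, hg.comp hf⟩

theorem top_quot [IsArtinianRing Λ] (hM : IsU Λ M) [Nontrivial N] (f : M →ₗ[Λ] N)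
    (hf : Function.Surjective f) {i : Fin s} (h : D.Top M i) : D.Top N i := by
  obtain ⟨j, hj⟩ := D.exists_top (hM.of_surjective f hf)
  rwa [D.top_unique hM h (D.top_of_surj f hf hj)]

theorem top_congr (e : M ≃ₗ[Λ] N) {i : Fin s} (h : D.Top M i) : D.Top N i :=
  D.top_of_surj e.symm.toLinearMap e.symm.surjective h

theorem coatom (i : Fin s) : IsCoatom (LinearMap.ker (D.π i)) :=
  have := D.simple i
  isCoatom_ker_of_surjective _ (D.hπ i)

theorem cover (h : IsU Λ M) {i : Fin s} (hi : D.Top M i) :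
    ∃ q : D.P i →ₗ[Λ] M, Function.Surjective q := by
  obtain ⟨f, hf⟩ := hi
  have := D.proj i
  have := D.simple i
  obtain ⟨q, hq⟩ := Module.projective_lifting_property f (D.π i) hf
  exact ⟨q, h.surjective_of_comp q f (by rw [hq]; exact D.hπ i)⟩

theorem equiv_P [IsArtinianRing Λ] (h : IsU Λ M) (hM : Module.Projective Λ M) {i : Fin s}
    (hi : D.Top M i) : Nonempty (D.P i ≃ₗ[Λ] M) := by
  obtain ⟨q, hq⟩ := D.cover h hi
  have := h.nt
  exact ⟨LinearEquiv.ofBijective q ⟨(D.U i).injective_of_split q hq, hq⟩⟩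

theorem top_coatom [IsArtinianRing Λ] (h : IsU Λ M) {i : Fin s} (hi : D.Top M i)
    {K : Submodule Λ M} (hK : IsCoatom K) (hK0 : K ≠ ⊥) : D.Top K (D.τ i) := by
  obtain ⟨q, hq⟩ := D.cover h hi
  have hc : IsCoatom (K.comap q) := by
    have h2 : IsSimpleModule Λ (M ⧸ K) := isSimpleModule_iff_isCoatom.mpr hK
    have := isCoatom_ker_of_surjective (K.mkQ.comp q) (K.mkQ_surjective.comp hq)
    rwa [LinearMap.ker_comp, Submodule.ker_mkQ] at this
  have he := (D.U i).coatom_unique hc (D.coatom i)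
  have hmap : ∀ x ∈ LinearMap.ker (D.π i), q x ∈ K := by
    intro x hx
    rw [← he] at hx
    exact hx
  have : Nontrivial K := Submodule.nontrivial_iff_ne_bot.mpr hK0
  refine D.top_quot ((D.U i).sub (D.hne i)) (q.restrict hmap) ?_ (D.hτ i)
  rintro ⟨y, hy⟩
  obtain ⟨x, rfl⟩ := hq y
  exact ⟨⟨x, by rw [← he]; exact hy⟩, rfl⟩

theorem top_sub [IsArtinianRing Λ] (k : ℕ) : ∀ {M : Type u} [AddCommGroup M] [Module Λ M]
    (_ : IsU Λ M) {i : Fin s} (_ : D.Top M i) (K : Submodule Λ M) (_ : K ≠ ⊥)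
    (_ : ell Λ M = ell Λ K + k), D.Top K (D.τ^[k] i) := by
  induction k with
  | zero =>
    intro M _ _ h i hi K hK hl
    have := h.fin
    have hK' : K = ⊤ := by
      by_contra hcon
      have := ell_lt hcon
      omega
    subst hK'
    exact D.top_congr Submodule.topEquiv.symm hi
  | succ k ih =>
    intro M _ _ h i hi K hK hl
    have := h.fin
    have hK' : K ≠ ⊤ := by
      rintro rfl
      rw [ell_congr (Submodule.topEquiv (R := Λ) (M := M))] at hl
      omega
    obtain ⟨A, hA, hKA⟩ := (eq_top_or_exists_le_coatom K).resolve_left hK'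
    have hA0 : A ≠ ⊥ := by
      rintro rfl
      exact hK (le_bot_iff.mp hKA)
    have h1 := D.top_coatom h hi hA hA0
    have e : (K.comap A.subtype) ≃ₗ[Λ] K := Submodule.comapSubtypeEquivOfLe hKA
    have h2 : ell Λ (M ⧸ A) = 1 := ell_eq_one_iff.mpr (isSimpleModule_iff_isCoatom.mpr hA)
    have h3 := ell_add A
    have h4 := ih (h.sub hA0) h1 (K.comap A.subtype) (by
      intro h0
      apply hK
      have := congrArg (Submodule.map A.subtype) h0
      rwa [Submodule.map_comap_subtype, Submodule.map_bot, inf_eq_right.mpr hKA] at this) (by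
      rw [ell_congr e]; omega)
    exact D.top_congr e h4

theorem top_simple {S : Type u} [AddCommGroup S] [Module Λ S] (h : IsSimpleModule Λ S)
    {i : Fin s} (hi : D.Top S i) : Nonempty (S ≃ₗ[Λ] (D.F i : Type u)) := by
  obtain ⟨f, hf⟩ := hi
  have := D.simple i
  have := IsSimpleModule.nontrivial Λ (D.F i)
  refine ⟨LinearEquiv.ofBijective f ⟨LinearMap.injective_of_ne_zero ?_, hf⟩⟩
  rintro rfl
  obtain ⟨x, hx⟩ := exists_ne (0 : D.F i)
  obtain ⟨y, hy⟩ := hf x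
  exact hx hy.symm

end Setup

end Aux2

section Aux3

variable {Λ}
variable {M N X : Type u} [AddCommGroup M] [Module Λ M] [AddCommGroup N] [Module Λ N]
  [AddCommGroup X] [Module Λ X]

theorem sup_equiv (A B : Submodule Λ M) (h : Disjoint A B) :
    ∃ e : (A × B) ≃ₗ[Λ] ↥(A ⊔ B), ∀ x, (e x : M) = x.1 + x.2 := by
  let f : (A × B) →ₗ[Λ] M := LinearMap.coprod A.subtype B.subtype
  have hf : Function.Injective f := by
    rw [← LinearMap.ker_eq_bot, eq_bot_iff]
    rintro ⟨a, b⟩ hab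
    have hab' : (a : M) + b = 0 := hab
    have ha : (a : M) = 0 := by
      apply Submodule.disjoint_def.mp h _ a.2
      rw [eq_neg_of_add_eq_zero_left hab']
      exact B.neg_mem b.2
    have hb : (b : M) = 0 := by simpa [ha] using hab'
    have ha' : a = 0 := Subtype.ext ha
    have hb' : b = 0 := Subtype.ext hb
    simp [ha', hb']
  have hr : LinearMap.range f = A ⊔ B := by
    simp [f, LinearMap.range_coprod]
  refine ⟨LinearEquiv.ofInjective f hf ≪≫ₗ LinearEquiv.ofEq _ _ hr, fun x => ?_⟩
  simp [f]

theorem extend_or [IsNakayama Λ] {P Q : Type u} [AddCommGroup P] [Module Λ P] [AddCommGroup Q]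
    [Module Λ Q] (hP : IsU Λ P) (hQ : IsU Λ Q) (hQp : Module.Projective Λ Q) (K : Submodule Λ P)
    (φ : K →ₗ[Λ] Q) : (∃ ψ : P →ₗ[Λ] Q, ψ.comp K.subtype = φ) ∨
      ∃ L : Submodule Λ P, K ≤ L ∧ L ≠ ⊤ ∧ Nonempty (L ≃ₗ[Λ] Q) := by
  have := hP.fin
  have := hQ.fin
  let g : K →ₗ[Λ] P × Q := LinearMap.prod K.subtype (-φ)
  let R := LinearMap.range g
  obtain ⟨y, hy0, hy⟩ := hQ.exists_socle_elt
  let jQ : Q →ₗ[Λ] (P × Q) ⧸ R := R.mkQ.comp (LinearMap.inr Λ P Q)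
  let jP : P →ₗ[Λ] (P × Q) ⧸ R := R.mkQ.comp (LinearMap.inl Λ P Q)
  have hj : ∀ n : K, jP n = jQ (φ n) := by
    intro n
    rw [← sub_eq_zero]
    change R.mkQ (LinearMap.inl Λ P Q n) - R.mkQ (LinearMap.inr Λ P Q (φ n)) = 0
    rw [← map_sub, Submodule.mkQ_apply, Submodule.Quotient.mk_eq_zero]
    exact ⟨n, by simp [g]⟩
  have hjy : jQ y ≠ 0 := by
    intro h
    change R.mkQ (LinearMap.inr Λ P Q y) = 0 at h
    rw [Submodule.mkQ_apply, Submodule.Quotient.mk_eq_zero] at h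
    obtain ⟨n, hn⟩ := h
    have h1 : (n : P) = 0 := congrArg Prod.fst hn
    have h2 : -φ n = y := congrArg Prod.snd hn
    have h3 : n = 0 := Subtype.ext h1
    rw [h3] at h2
    exact hy0 (by simpa using h2.symm)
  obtain ⟨V, pr, -, hV, hpr⟩ := exists_summand (Λ := Λ) (jQ y) hjy
  let ι := pr.comp jQ
  let ψ := pr.comp jP
  have hι : Function.Injective ι := by
    rw [← LinearMap.ker_eq_bot]
    by_contra hcon
    exact hpr (hy _ hcon)
  have hψ : ∀ n : K, ψ n = ι (φ n) := fun n => congrArg pr (hj n)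
  let e := LinearEquiv.ofInjective ι hι
  by_cases hle : LinearMap.range ψ ≤ LinearMap.range ι
  · left
    refine ⟨e.symm.toLinearMap.comp (ψ.codRestrict _ (fun x => hle ⟨x, rfl⟩)), ?_⟩
    ext n
    change e.symm _ = _
    rw [LinearEquiv.symm_apply_eq]
    apply Subtype.ext
    exact hψ n
  · right
    have hle' := (hV.us (LinearMap.range ψ) (LinearMap.range ι)).resolve_left hle
    let L := (LinearMap.range ι).comap ψ
    let f : L →ₗ[Λ] LinearMap.range ι := ψ.restrict (fun x hx => hx)
    have hf : Function.Surjective f := by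
      rintro ⟨z, hz⟩
      obtain ⟨x, rfl⟩ := hle' hz
      exact ⟨⟨x, hz⟩, rfl⟩
    have hpj : Module.Projective Λ (LinearMap.range ι) := Module.Projective.of_equiv e
    have := hQ.nt
    have hnt : Nontrivial (LinearMap.range ι) := e.symm.toEquiv.nontrivial
    have hL : L ≠ ⊥ := by
      intro h
      have hs : Subsingleton L := (Submodule.subsingleton_iff_eq_bot).mpr h
      have := hf.subsingleton
      exact not_subsingleton _ this
    have hinj : Function.Injective f := IsU.injective_of_split (M := L) (N := LinearMap.range ι) (hP.sub hL) f hf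
    refine ⟨L, ?_, ?_, ⟨LinearEquiv.ofBijective f ⟨hinj, hf⟩ ≪≫ₗ e.symm⟩⟩
    · intro n hn
      exact ⟨φ ⟨n, hn⟩, (hψ ⟨n, hn⟩).symm⟩
    · intro h
      apply hle
      rintro _ ⟨x, rfl⟩
      have : x ∈ L := by rw [h]; trivial
      exact this

theorem proj_up [IsArtinianRing Λ] {s : ℕ} (D : Setup Λ s) (h : IsU Λ M) {K L : Submodule Λ M}
    (hK : K ≠ ⊥) (hKL : K ≤ L) (hKp : Module.Projective Λ K) : Module.Projective Λ L := by
  have hL : L ≠ ⊥ := by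
    rintro rfl
    exact hK (le_bot_iff.mp hKL)
  have hLU := h.sub hL
  obtain ⟨i, hi⟩ := D.exists_top hLU
  obtain ⟨q, hq⟩ := D.cover hLU hi
  let A := (K.comap L.subtype).comap q
  let f : A →ₗ[Λ] K := (L.subtype.comp q).restrict (fun x hx => hx)
  have hf : Function.Surjective f := by
    rintro ⟨z, hz⟩
    obtain ⟨x, hx⟩ := hq ⟨z, hKL hz⟩
    have hxz : L.subtype (q x) = z := by rw [hx]; rfl
    refine ⟨⟨x, ?_⟩, Subtype.ext hxz⟩
    change L.subtype (q x) ∈ K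
    rw [hxz]; exact hz
  have hnt : Nontrivial K := Submodule.nontrivial_iff_ne_bot.mpr hK
  have hA : A ≠ ⊥ := by
    intro h
    have hs : Subsingleton A := (Submodule.subsingleton_iff_eq_bot).mpr h
    exact not_subsingleton _ hf.subsingleton
  have hinj := ((D.U i).sub hA).injective_of_split f hf
  have hq' : Function.Injective q := by
    rw [← LinearMap.ker_eq_bot, eq_bot_iff]
    intro x hx
    have hx0 : q x = 0 := hx
    have hxA : x ∈ A := by
      change L.subtype (q x) ∈ K
      rw [hx0]; simp
    have : f ⟨x, hxA⟩ = f 0 := by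
      apply Subtype.ext
      change L.subtype (q x) = _
      rw [hx0]; simp
    have := hinj this
    simpa using congrArg Subtype.val this
  have := D.proj i
  exact Module.Projective.of_equiv (LinearEquiv.ofBijective q ⟨hq', hq⟩)

/-- maps to `Λ` extend if maps to indecomposable projectives do. -/
theorem extend_ring [IsNakayama Λ] {s : ℕ} (D : Setup Λ s) (K : Submodule Λ M)
    (hext : ∀ i, ∀ φ : K →ₗ[Λ] D.P i, ∃ ψ : M →ₗ[Λ] D.P i, ψ.comp K.subtype = φ)
    (φ : K →ₗ[Λ] Λ) : ∃ ψ : M →ₗ[Λ] Λ, ψ.comp K.subtype = φ := by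
  by_contra hcon
  obtain ⟨Q, r, hr, hU, φ, hp⟩ := exists_min_summand
    (fun Q : Submodule Λ Λ => ∃ φ : K →ₗ[Λ] Q, ¬ ∃ ψ : M →ₗ[Λ] Q, ψ.comp K.subtype = φ)
    (by
      refine ⟨(Submodule.topEquiv (R := Λ) (M := Λ)).symm.toLinearMap.comp φ, ?_⟩
      rintro ⟨ψ, hψ⟩
      apply hcon
      refine ⟨(Submodule.topEquiv (R := Λ) (M := Λ)).toLinearMap.comp ψ, ?_⟩
      rw [LinearMap.comp_assoc, hψ]
      ext x; simp)
    (by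
      rintro ⟨φ, h⟩
      exact h ⟨0, Subsingleton.elim _ _⟩)
    (by
      rintro A B hAB ⟨φ, h⟩
      obtain ⟨e, -⟩ := sup_equiv A B hAB
      by_contra hc
      push Not at hc
      obtain ⟨ψ1, h1⟩ := hc.1 ((LinearMap.fst Λ A B).comp (e.symm.toLinearMap.comp φ))
      obtain ⟨ψ2, h2⟩ := hc.2 ((LinearMap.snd Λ A B).comp (e.symm.toLinearMap.comp φ))
      apply h
      refine ⟨e.toLinearMap.comp (ψ1.prod ψ2), ?_⟩
      apply LinearMap.ext
      intro x
      change e (ψ1 x, ψ2 x) = φ x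
      rw [← LinearEquiv.eq_symm_apply]
      exact Prod.ext (LinearMap.congr_fun h1 x) (LinearMap.congr_fun h2 x))
  apply hp
  have hQ : Module.Projective Λ Q := Module.Projective.of_split Q.subtype r hr
  obtain ⟨i, hi⟩ := D.exists_top hU
  obtain ⟨e⟩ := D.equiv_P hU hQ hi
  obtain ⟨ψ, hψ⟩ := hext i (e.symm.toLinearMap.comp φ)
  refine ⟨e.toLinearMap.comp ψ, ?_⟩
  rw [LinearMap.comp_assoc, hψ]
  ext x; simp

theorem extend_proj [IsArtinianRing Λ] [Module.Finite Λ M] (K : Submodule Λ M)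
    (hext : ∀ φ : K →ₗ[Λ] Λ, ∃ ψ : M →ₗ[Λ] Λ, ψ.comp K.subtype = φ)
    (hX : Module.Projective Λ X) (φ : K →ₗ[Λ] X) : ∃ ψ : M →ₗ[Λ] X, ψ.comp K.subtype = φ := by
  classical
  obtain ⟨σ, hσ⟩ := Module.projective_def'.mp hX
  have hKf : Module.Finite Λ K := inferInstance
  obtain ⟨S, hS⟩ := hKf.fg_top
  let θ : K →ₗ[Λ] (X →₀ Λ) := σ.comp φ
  choose E hE using fun a : X => hext ((Finsupp.lapply a).comp θ)
  let t : Finset X := S.biUnion fun k => (θ k).support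
  let Ψ : M →ₗ[Λ] (X →₀ Λ) := ∑ a ∈ t, (Finsupp.lsingle a).comp (E a)
  have hΨ : Ψ.comp K.subtype = θ := by
    apply LinearMap.ext_on (s := (S : Set K)) hS
    intro k hk
    ext a
    have hEa : ∀ a, E a k = θ k a := fun a => LinearMap.congr_fun (hE a) k
    simp only [Ψ, LinearMap.comp_apply, LinearMap.sum_apply, Submodule.subtype_apply, hEa,
      Finsupp.lsingle_apply, Finsupp.finsetSum_apply, Finsupp.single_apply]
    rw [Finset.sum_ite_eq' t a]
    split_ifs with h
    · rfl
    · by_contra hne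
      apply h
      exact Finset.mem_biUnion.mpr ⟨k, hk, by simpa using Ne.symm hne⟩
  refine ⟨(Finsupp.linearCombination Λ id).comp Ψ, ?_⟩
  rw [LinearMap.comp_assoc, hΨ, ← LinearMap.comp_assoc, hσ, LinearMap.id_comp]

end Aux3

section Aux4

variable {Λ}
variable {M N X : Type u} [AddCommGroup M] [Module Λ M] [AddCommGroup N] [Module Λ N]
  [AddCommGroup X] [Module Λ X]

theorem exists_functional (hX : Module.Projective Λ X) {x : X} (hx : x ≠ 0) :
    ∃ h : X →ₗ[Λ] Λ, h x ≠ 0 := by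
  obtain ⟨σ, hσ⟩ := Module.projective_def'.mp hX
  by_contra hcon
  push Not at hcon
  apply hx
  have h1 : σ x = 0 := by
    ext a
    exact hcon ((Finsupp.lapply a).comp σ)
  have := LinearMap.congr_fun hσ x
  simpa [h1] using this.symm

theorem coatom_comap [IsArtinianRing Λ] (f : M →ₗ[Λ] N) (hf : Function.Surjective f)
    {A : Submodule Λ N} (hA : IsCoatom A) : IsCoatom (A.comap f) := by
  have h2 : IsSimpleModule Λ (N ⧸ A) := isSimpleModule_iff_isCoatom.mpr hA
  have := isCoatom_ker_of_surjective (A.mkQ.comp f) (A.mkQ_surjective.comp hf)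
  rwa [LinearMap.ker_comp, Submodule.ker_mkQ] at this

namespace Setup

variable {s : ℕ} (D : Setup Λ s)

theorem cover_equiv [IsArtinianRing Λ] (p : M →ₗ[Λ] N) (hp : IsProjCover p) {i : Fin s}
    (e : N ≃ₗ[Λ] (D.F i : Type u)) : Nonempty (M ≃ₗ[Λ] D.P i) := by
  have hpp := hp.projective
  have := D.simple i
  obtain ⟨g, hg⟩ := Module.projective_lifting_property (D.π i) (e.toLinearMap.comp p) (D.hπ i)
  have hgs : Function.Surjective g := (D.U i).surjective_of_comp g (D.π i)
    (by rw [hg]; exact e.surjective.comp hp.surjective)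
  have := D.proj i
  obtain ⟨σ, hσ⟩ := Module.projective_lifting_property g LinearMap.id hgs
  have hσ' : ∀ x, g (σ x) = x := fun x => LinearMap.congr_fun hσ x
  refine ⟨LinearEquiv.ofBijective g ⟨?_, hgs⟩⟩
  rw [injective_iff_map_eq_zero]
  intro x hx
  by_contra hx0
  obtain ⟨h, hh⟩ := exists_functional hpp hx0
  let ρ : M →ₗ[Λ] M := LinearMap.id - σ.comp g
  let h' : M →ₗ[Λ] Λ := h.comp ρ
  have hx' : h' x = h x := by simp [h', ρ, hx]
  have hnt : Nontrivial (LinearMap.range h') := by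
    refine ⟨⟨⟨h' x, ⟨x, rfl⟩⟩, 0, ?_⟩⟩
    intro h0
    apply hh
    rw [← hx']
    exact congrArg Subtype.val h0
  have hfin : Module.Finite Λ (LinearMap.range h') := inferInstance
  obtain ⟨A, hA, -⟩ :=
    (eq_top_or_exists_le_coatom (⊥ : Submodule Λ (LinearMap.range h'))).resolve_left bot_ne_top
  have hB := coatom_comap h'.rangeRestrict h'.surjective_rangeRestrict hA
  apply hB.1
  rw [eq_top_iff]
  rintro z -
  have h1 : LinearMap.ker p ≤ A.comap h'.rangeRestrict :=
    hp.superfluous.trans (sInf_le hB)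
  have h2 : z = (z - σ (g z)) + σ (g z) := by abel
  rw [h2]
  apply Submodule.add_mem
  · apply h1
    have h3 : g (z - σ (g z)) = 0 := by rw [map_sub, hσ', sub_self]
    have h4 := LinearMap.congr_fun hg (z - σ (g z))
    rw [LinearMap.comp_apply, h3, map_zero] at h4
    rw [LinearMap.mem_ker]
    apply e.injective
    rw [map_zero]
    exact h4.symm
  · have h5 : h'.rangeRestrict (σ (g z)) = 0 := by
      apply Subtype.ext
      change h (σ (g z) - σ (g (σ (g z)))) = 0
      rw [hσ', sub_self, map_zero]
    rw [Submodule.mem_comap, h5]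
    exact A.zero_mem

theorem isProjCover_π {i : Fin s} (e : (D.F i : Type u) ≃ₗ[Λ] N) :
    IsProjCover (e.toLinearMap.comp (D.π i)) := by
  refine ⟨D.proj i, e.surjective.comp (D.hπ i), ?_⟩
  rw [LinearEquiv.ker_comp, (D.U i).radical (D.coatom i)]

theorem red_iff [IsArtinianRing Λ] {i : Fin s} (e : N ≃ₗ[Λ] (D.F i : Type u)) :
    IsRedSimple Λ N ↔ Module.Projective Λ (LinearMap.ker (D.π i)) := by
  have := D.simple i
  constructor
  · rintro ⟨hs, P, p, hp, hk⟩
    obtain ⟨e'⟩ := D.cover_equiv p hp e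
    have hU : IsU Λ P := (D.U i).congr e'.symm
    have h1 := coatom_comap e'.toLinearMap e'.surjective (D.coatom i)
    have h2 := hU.coatom_unique (isCoatom_ker_of_surjective p hp.surjective) h1
    exact Module.Projective.of_equiv
      (LinearEquiv.ofEq _ _ h2 ≪≫ₗ e'.ofSubmodule' (LinearMap.ker (D.π i)))
  · intro h
    refine ⟨IsSimpleModule.congr e, ModuleCat.of Λ (D.P i), e.symm.toLinearMap.comp (D.π i),
      D.isProjCover_π e.symm, ?_⟩
    rw [LinearEquiv.ker_comp]
    exact h

theorem gamma_fwd [IsNakayama Λ] (h : GammaRel Λ M N) {i : Fin s}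
    (e : M ≃ₗ[Λ] (D.F i : Type u)) :
    Nonempty (N ≃ₗ[Λ] (D.F (D.τ^[D.c i] i) : Type u)) := by
  obtain ⟨hs, P, p, hp, V, hV, ⟨j, hj, -⟩, -, hT, L, hL2, ⟨-, q, hq, hqr⟩, t, ht, -⟩ := h
  obtain ⟨e'⟩ := D.cover_equiv p hp e
  have := D.simple i
  have hU : IsU Λ P := (D.U i).congr e'.symm
  have hPf := hU.fin
  have htop : D.Top P i := ⟨e.toLinearMap.comp p, e.surjective.comp hp.surjective⟩
  -- index of V
  have ej := LinearEquiv.ofInjective j hj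
  have hVs : IsSimpleModule Λ (LinearMap.range j) := IsSimpleModule.congr ej.symm
  have hj0 : LinearMap.range j ≠ ⊥ :=
    Submodule.nontrivial_iff_ne_bot.mp (IsSimpleModule.nontrivial Λ _)
  have hl : ell Λ (LinearMap.range j) = 1 := ell_eq_one_iff.mpr hVs
  have hcP : ell Λ P = D.c i := ell_congr e'
  have hadd := ell_add (LinearMap.range j)
  have hcpos : D.c i = 1 + (D.c i - 1) := by omega
  have h1 := D.top_sub (D.c i - 1) hU htop (LinearMap.range j) hj0 (by rw [hl]; omega)
  have h1V := D.top_congr ej.symm h1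
  obtain ⟨eV⟩ := D.top_simple hV h1V
  -- structure of L
  obtain ⟨hLf, hLl⟩ := hasLength_imp hL2
  have hL2' : ell Λ L = 2 := by
    have h := hLl
    rw [length_coe] at h
    exact_mod_cast h
  have hq' := isCoatom_ker_of_surjective q hq
  have hqs : IsSimpleModule Λ (L ⧸ LinearMap.ker q) := isSimpleModule_iff_isCoatom.mpr hq'
  have hk1 : ell Λ (LinearMap.ker q) = 1 := by
    have := ell_add (LinearMap.ker q)
    have h2 : ell Λ (L ⧸ LinearMap.ker q) = 1 := ell_eq_one_iff.mpr hqs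
    omega
  have hks : IsSimpleModule Λ (LinearMap.ker q) := ell_eq_one_iff.mp hk1
  have hka : IsAtom (LinearMap.ker q) := isSimpleModule_iff_isAtom.mp hks
  have hco : ∀ A : Submodule Λ L, A ≠ ⊤ → A ≤ LinearMap.ker q := by
    intro A hA
    obtain ⟨B, hB, hAB⟩ := (eq_top_or_exists_le_coatom A).resolve_left hA
    have : LinearMap.ker q ≤ B := by rw [hqr]; exact sInf_le hB
    rw [hq'.le_iff_eq hB.1] at this
    rwa [← this]
  have hLU : IsU Λ L := by
    refine ⟨?_, ?_, hLf⟩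
    · by_contra hcon
      rw [not_nontrivial_iff_subsingleton] at hcon
      have := Module.length_eq_zero (R := Λ) (M := L)
      rw [this] at hLl
      norm_num at hLl
    · intro A B
      by_cases hA : A = ⊤
      · right; rw [hA]; exact le_top
      by_cases hB : B = ⊤
      · left; rw [hB]; exact le_top
      by_cases hA0 : A = ⊥
      · left; rw [hA0]; exact bot_le
      by_cases hB0 : B = ⊥
      · right; rw [hB0]; exact bot_le
      left
      rw [(hka.le_iff_eq hA0).mp (hco A hA)]
      exact ((hka.le_iff_eq hB0).mp (hco B hB)).ge
  have et := LinearEquiv.ofInjective t ht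
  have hts : IsSimpleModule Λ (LinearMap.range t) := IsSimpleModule.congr et.symm
  have ht1 : ell Λ (LinearMap.range t) = 1 := ell_eq_one_iff.mpr hts
  have ht0 : LinearMap.range t ≠ ⊥ :=
    Submodule.nontrivial_iff_ne_bot.mp (IsSimpleModule.nontrivial Λ _)
  have h3 := D.top_sub 1 hLU (i := D.τ^[D.c i - 1] i)
    ⟨eV.toLinearMap.comp q, eV.surjective.comp hq⟩ (LinearMap.range t) ht0 (by omega)
  have h4 := D.top_congr et.symm h3
  have h5 : D.τ^[1] (D.τ^[D.c i - 1] i) = D.τ^[D.c i] i := by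
    rw [← Function.iterate_add_apply, ← hcpos]
  rw [h5] at h4
  exact D.top_simple hT h4

theorem isSocleOf_of [IsArtinianRing Λ] (hU : IsU Λ M) {A : Submodule Λ M}
    (hA : IsSimpleModule Λ A) {j : Fin s} (hj : D.Top A j) :
    IsSocleOf Λ (D.F j : Type u) M := by
  obtain ⟨e⟩ := D.top_simple hA hj
  refine ⟨A.subtype.comp e.symm.toLinearMap, A.subtype_injective.comp e.symm.injective, ?_⟩
  rw [LinearMap.range_comp, LinearEquiv.range, Submodule.map_subtype_top,
    hU.socle (isSimpleModule_iff_isAtom.mp hA)]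

theorem c_ge_two [IsArtinianRing Λ] (i : Fin s) : 2 ≤ D.c i := by
  have := (D.U i).fin
  have h1 := ell_lt (D.coatom i).1
  have : Nontrivial (LinearMap.ker (D.π i)) := Submodule.nontrivial_iff_ne_bot.mpr (D.hne i)
  have h2 := ell_pos (Λ := Λ) (M := LinearMap.ker (D.π i))
  unfold c
  omega

theorem gamma_bwd [IsNakayama Λ] (i : Fin s) :
    GammaRel Λ (D.F i : Type u) (D.F (D.τ^[D.c i] i) : Type u) := by
  have hc := D.c_ge_two i
  have hf := (D.U i).fin
  have := (D.U i).nt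
  refine ⟨D.simple i, ModuleCat.of Λ (D.P i), D.π i,
    D.isProjCover_π (LinearEquiv.refl _ _), D.F (D.τ^[D.c i - 1] i), D.simple _, ?_,
    D.simple _, D.simple _, ?_⟩
  · obtain ⟨A, hA, -⟩ :=
      (eq_bot_or_exists_atom_le (⊤ : Submodule Λ (D.P i))).resolve_left top_ne_bot
    have hAs : IsSimpleModule Λ A := isSimpleModule_iff_isAtom.mpr hA
    have hA1 : ell Λ A = 1 := ell_eq_one_iff.mpr hAs
    exact D.isSocleOf_of (D.U i) hAs
      (D.top_sub (D.c i - 1) (D.U i) ⟨_, D.hπ i⟩ A hA.1 (by unfold c at *; omega))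
  · set v := D.τ^[D.c i - 1] i with hv
    have hcv := D.c_ge_two v
    have hf := (D.U v).fin
    have hUK := (D.U v).sub (D.hne v)
    have hntK := hUK.nt
    have hfK := hUK.fin
    obtain ⟨A, hA, -⟩ := (eq_top_or_exists_le_coatom
      (⊥ : Submodule Λ (LinearMap.ker (D.π v)))).resolve_left bot_ne_top
    let B := A.map (LinearMap.ker (D.π v)).subtype
    have hB : B ≠ ⊤ := by
      intro h
      apply (D.coatom v).1
      rw [eq_top_iff, ← h]
      exact Submodule.map_subtype_le _ _
    have hBl : ell Λ B = ell Λ A :=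
      (ell_congr (Submodule.equivMapOfInjective _ (Submodule.subtype_injective _) A)).symm
    have hLU := (D.U v).quot hB
    have hL2 : ell Λ (D.P v ⧸ B) = 2 := by
      have h1 := ell_add B
      have h2 := ell_add A
      have h3 := ell_add (LinearMap.ker (D.π v))
      have h4 : ell Λ (LinearMap.ker (D.π v) ⧸ A) = 1 :=
        ell_eq_one_iff.mpr (isSimpleModule_iff_isCoatom.mpr hA)
      have h5 : ell Λ (D.P v ⧸ LinearMap.ker (D.π v)) = 1 :=
        ell_eq_one_iff.mpr (isSimpleModule_iff_isCoatom.mpr (D.coatom v))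
      omega
    have hLf := hLU.fin
    have := hLU.nt
    obtain ⟨q, hq⟩ : D.Top (D.P v ⧸ B) v :=
      D.top_quot (D.U v) B.mkQ B.mkQ_surjective ⟨_, D.hπ v⟩
    have := D.simple v
    have hqc := isCoatom_ker_of_surjective q hq
    have hk1 : ell Λ (LinearMap.ker q) = 1 := by
      have := ell_add (LinearMap.ker q)
      have h2 : ell Λ ((D.P v ⧸ B) ⧸ LinearMap.ker q) = 1 :=
        ell_eq_one_iff.mpr (isSimpleModule_iff_isCoatom.mpr hqc)
      omega
    have hks : IsSimpleModule Λ (LinearMap.ker q) := ell_eq_one_iff.mp hk1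
    refine ⟨ModuleCat.of Λ (D.P v ⧸ B), ?_, ⟨D.simple v, q, hq, (hLU.radical hqc).symm⟩, ?_⟩
    · rw [← hL2]; exact hasLength_of
    · have h3 := D.top_coatom hLU ⟨q, hq⟩ hqc (isSimpleModule_iff_isAtom.mp hks).1
      have h4 : D.τ v = D.τ^[D.c i] i := by
        rw [hv, ← Function.iterate_succ_apply' D.τ]
        congr 1; omega
      rw [h4] at h3
      exact D.isSocleOf_of hLU hks h3

end Setup

end Aux4

section Aux5

variable {Λ}

namespace Setup

variable {s : ℕ} (D : Setup Λ s)

theorem embed_P [IsNakayama Λ] {M : Type u} [AddCommGroup M] [Module Λ M] (hM : IsU Λ M)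
    {X : Type u} [AddCommGroup X] [Module Λ X] (hX : Module.Projective Λ X)
    (a : M →ₗ[Λ] X) (ha : Function.Injective a) :
    ∃ i, ∃ ι : M →ₗ[Λ] D.P i, Function.Injective ι := by
  obtain ⟨y, hy0, hy⟩ := hM.exists_socle_elt
  have hay : a y ≠ 0 := by
    intro h
    exact hy0 (ha (by rw [h, map_zero]))
  obtain ⟨h, hh⟩ := exists_functional hX hay
  obtain ⟨Q, r, hr, hU, hry⟩ := exists_summand (Λ := Λ) (h (a y)) hh
  have hQ : Module.Projective Λ Q := Module.Projective.of_split Q.subtype r hr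
  obtain ⟨i, hi⟩ := D.exists_top hU
  obtain ⟨e⟩ := D.equiv_P hU hQ hi
  have hinj : Function.Injective (r.comp (h.comp a)) := by
    rw [← LinearMap.ker_eq_bot]
    by_contra hcon
    exact hry (hy _ hcon)
  exact ⟨i, e.symm.toLinearMap.comp (r.comp (h.comp a)), e.symm.injective.comp hinj⟩

/-- the cosyzygy step -/
theorem step [IsNakayama Λ] {P : ℤ → ModuleCat.{u} Λ} {d : ∀ i, P (i + 1) →ₗ[Λ] P i}
    (hproj : ∀ i, Module.Projective Λ (P i))
    (hex : ∀ i, Function.Exact (d (i + 1)) (d i))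
    (hext : ∀ (i : ℤ) (φ : P (i + 1) →ₗ[Λ] Λ), φ.comp (d (i + 1)) = 0 →
      ∃ ψ : P i →ₗ[Λ] Λ, ψ.comp (d i) = φ)
    {M : Type u} [AddCommGroup M] [Module Λ M] (hM : IsU Λ M) (hMp : ¬ Module.Projective Λ M)
    (z : ℤ) (a : M →ₗ[Λ] LinearMap.range (d z)) (b : LinearMap.range (d z) →ₗ[Λ] M)
    (hab : Function.Injective (b.comp a)) :
    ∃ (i : Fin s) (K : Submodule Λ (D.P i)), K ≠ ⊥ ∧ K ≠ ⊤ ∧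
      ¬ Module.Projective Λ (LinearMap.ker (D.π i)) ∧
      (∃ (z' : ℤ) (a' : (D.P i ⧸ K) →ₗ[Λ] LinearMap.range (d z'))
        (b' : LinearMap.range (d z') →ₗ[Λ] (D.P i ⧸ K)), Function.Injective (b'.comp a')) ∧
      D.Top M (D.τ^[ell Λ (D.P i ⧸ K)] i) ∧ D.c i = ell Λ M + ell Λ (D.P i ⧸ K) := by
  classical
  obtain ⟨j, rfl⟩ : ∃ j, z = j + 1 := ⟨z - 1, by ring⟩
  have hMnt := hM.nt
  have hMfin := hM.fin
  have ha : Function.Injective a := fun x y h => hab (by simp [h])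
  let aX : M →ₗ[Λ] P (j + 1) := (LinearMap.range (d (j + 1))).subtype.comp a
  have haX : Function.Injective aX := (Submodule.subtype_injective _).comp ha
  have hE : ∃ n, ∃ i, D.c i = n ∧ ∃ ι : M →ₗ[Λ] D.P i, Function.Injective ι := by
    obtain ⟨i, ι, hι⟩ := D.embed_P hM (hproj _) aX haX
    exact ⟨_, i, rfl, ι, hι⟩
  obtain ⟨i, hci, ι, hι⟩ := Nat.find_spec hE
  have hmin : ∀ i', D.c i' < D.c i → ∀ ι' : M →ₗ[Λ] D.P i', ¬ Function.Injective ι' := by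
    intro i' hlt ι' hι'
    rw [hci] at hlt
    exact Nat.find_min hE hlt ⟨i', rfl, ι', hι'⟩
  have hUi := D.U i
  have hfi := hUi.fin
  have hpi := D.proj i
  let K := LinearMap.range ι
  let eK : M ≃ₗ[Λ] K := LinearEquiv.ofInjective ι hι
  have hK0 : K ≠ ⊥ := Submodule.nontrivial_iff_ne_bot.mp eK.symm.toEquiv.nontrivial
  have hKp : ¬ Module.Projective Λ K := fun h => hMp (Module.Projective.of_equiv eK.symm)
  have hKt : K ≠ ⊤ := by
    intro h
    apply hKp
    rw [h]
    exact Module.Projective.of_equiv (Submodule.topEquiv (R := Λ) (M := D.P i)).symm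
  -- no proper projective submodule contains K
  have hno : ∀ L : Submodule Λ (D.P i), K ≤ L → L ≠ ⊤ → ¬ Module.Projective Λ L := by
    intro L hKL hL hLp
    have hL0 : L ≠ ⊥ := by
      rintro rfl
      exact hK0 (le_bot_iff.mp hKL)
    have hLU := hUi.sub hL0
    obtain ⟨i', hi'⟩ := D.exists_top hLU
    obtain ⟨e⟩ := D.equiv_P hLU hLp hi'
    refine hmin i' ?_ (e.symm.toLinearMap.comp ((Submodule.inclusion hKL).comp eK.toLinearMap)) ?_
    · unfold c
      rw [ell_congr e]
      exact ell_lt hL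
    · exact e.symm.injective.comp ((Submodule.inclusion_injective hKL).comp eK.injective)
  have hext1 : ∀ i', ∀ φ : K →ₗ[Λ] D.P i', ∃ ψ : D.P i →ₗ[Λ] D.P i', ψ.comp K.subtype = φ := by
    intro i' φ
    rcases extend_or hUi (D.U i') (D.proj i') K φ with h | ⟨L, hKL, hL, ⟨e⟩⟩
    · exact h
    · exfalso
      have := D.proj i'
      exact hno L hKL hL (Module.Projective.of_equiv e.symm)
  obtain ⟨E, hEx⟩ := extend_proj K (fun φ => extend_ring D K hext1 φ) (hproj (j + 1))
    (aX.comp eK.symm.toLinearMap)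
  have hEι : ∀ m, E (ι m) = a m := by
    intro m
    have := LinearMap.congr_fun hEx (eK m)
    have h2 : eK.symm (eK m) = m := eK.symm_apply_apply m
    change E (ι m) = aX (eK.symm (eK m)) at this
    rw [this, h2]
    rfl
  -- extension of b
  obtain ⟨B0, hB0⟩ := hext (j + 1)
    ((D.P i).subtype.comp (ι.comp (b.comp (d (j + 1)).rangeRestrict))) (by
      apply LinearMap.ext
      intro x
      have h1 : (d (j + 1)).rangeRestrict (d (j + 1 + 1) x) = 0 :=
        Subtype.ext ((hex (j + 1)).apply_apply_eq_zero x)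
      simp only [LinearMap.comp_apply, h1, map_zero, LinearMap.zero_apply])
  let B : P (j + 1) →ₗ[Λ] D.P i := (D.r i).comp B0
  have hB : ∀ y : LinearMap.range (d (j + 1)), B y = ι (b y) := by
    rintro ⟨_, x, rfl⟩
    have h1 := LinearMap.congr_fun hB0 x
    have h2 : B (d (j + 1) x) = D.r i (B0.comp (d (j + 1)) x) := rfl
    change B (d (j + 1) x) = _
    rw [h2, h1]
    exact LinearMap.congr_fun (D.hr i) _
  have hBE : ∀ m, B (E (ι m)) = ι (b (a m)) := by
    intro m
    rw [hEι, hB]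
  have hBEinj : Function.Injective (B.comp E) := by
    obtain ⟨y, hy0, hy⟩ := hUi.exists_socle_elt
    rw [← LinearMap.ker_eq_bot]
    by_contra hcon
    obtain ⟨m, hm⟩ := hy K hK0
    have h1 : B (E y) = 0 := hy _ hcon
    rw [← hm, hBE] at h1
    apply hy0
    rw [← hm]
    have : m = 0 := hab (by
      apply hι
      rw [LinearMap.comp_apply, h1, map_zero, map_zero])
    rw [this, map_zero]
  have hBEsurj : Function.Surjective (B.comp E) :=
    (IsArtinian.bijective_of_injective_endomorphism _ hBEinj).2
  refine ⟨i, K, hK0, hKt, hno _ (hUi.le_coatom (D.coatom i) hKt) (D.coatom i).1, ?_, ?_, ?_⟩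
  · let a' : (D.P i ⧸ K) →ₗ[Λ] LinearMap.range (d j) :=
      K.liftQ ((d j).rangeRestrict.comp E) (by
        rintro _ ⟨m, rfl⟩
        rw [LinearMap.mem_ker, LinearMap.comp_apply, hEι]
        obtain ⟨x, hx⟩ := (a m).2
        apply Subtype.ext
        rw [← hx]
        exact (hex j).apply_apply_eq_zero x)
    let b1 : (P (j + 1) ⧸ LinearMap.ker (d j)) →ₗ[Λ] (D.P i ⧸ K) :=
      (LinearMap.ker (d j)).liftQ (K.mkQ.comp B) (by
        intro x hx
        obtain ⟨w, rfl⟩ := (hex j x).mp hx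
        rw [LinearMap.mem_ker, LinearMap.comp_apply, Submodule.mkQ_apply,
          Submodule.Quotient.mk_eq_zero]
        rw [hB ⟨_, w, rfl⟩]
        exact ⟨_, rfl⟩)
    let b' := b1.comp (d j).quotKerEquivRange.symm.toLinearMap
    have hcomp : ∀ x, b' (a' (K.mkQ x)) = K.mkQ (B (E x)) := by
      intro x
      have h1 : a' (K.mkQ x) = (d j).quotKerEquivRange ((LinearMap.ker (d j)).mkQ (E x)) := by
        apply Subtype.ext
        rfl
      rw [h1]
      change b1 ((d j).quotKerEquivRange.symm _) = _
      rw [LinearEquiv.symm_apply_apply]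
      rfl
    refine ⟨j, a', b', ?_⟩
    apply IsNoetherian.injective_of_surjective_endomorphism
    intro y
    obtain ⟨y, rfl⟩ := K.mkQ_surjective y
    obtain ⟨x, rfl⟩ := hBEsurj y
    exact ⟨K.mkQ x, hcomp x⟩
  · have h1 := D.top_sub (ell Λ (D.P i ⧸ K)) hUi ⟨_, D.hπ i⟩ K hK0 (ell_add K)
    exact D.top_congr eK.symm h1
  · rw [ell_congr eK]
    exact ell_add K

theorem cmfree_of_red [IsNakayama Λ] {s : ℕ} (D : Setup Λ s) (h : EveryCycleHasRed Λ) : IsCMFree Λ := by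
  intro M _ _ ⟨n, hn⟩ ⟨P, d, hproj, hex, hext, ⟨e⟩⟩
  by_contra hMp
  have hMf := (hasLength_imp hn).1
  obtain ⟨Q, r, hr, hU, hQ⟩ := exists_min_summand (fun A : Submodule Λ M => ¬ Module.Projective Λ A)
    (fun h => hMp (Module.Projective.of_equiv (Submodule.topEquiv (R := Λ) (M := M))))
    (fun h => h inferInstance)
    (by
      intro A B hAB h
      by_contra hcon
      push Not at hcon
      have := hcon.1
      have := hcon.2
      obtain ⟨e, -⟩ := sup_equiv A B hAB
      exact h (Module.Projective.of_equiv e))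
  let St := {x : Fin s × ℕ // ¬ Module.Projective Λ (LinearMap.ker (D.π x.1)) ∧
    ∃ K : Submodule Λ (D.P x.1), K ≠ ⊥ ∧ K ≠ ⊤ ∧ x.2 = ell Λ (D.P x.1 ⧸ K) ∧
      (∃ (z' : ℤ) (a' : (D.P x.1 ⧸ K) →ₗ[Λ] LinearMap.range (d z'))
        (b' : LinearMap.range (d z') →ₗ[Λ] (D.P x.1 ⧸ K)), Function.Injective (b'.comp a'))}
  have hstart : Nonempty St := by
    obtain ⟨i, K, h1, h2, h3, h4, -, -⟩ := D.step hproj hex hext hU hQ 0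
      (e.toLinearMap.comp Q.subtype) (r.comp e.symm.toLinearMap) (by
        intro x y hxy
        have h1 : ∀ x, r (Q.subtype x) = x := fun x => LinearMap.congr_fun hr x
        have h2 : r (Q.subtype x) = r (Q.subtype y) := by simpa using hxy
        rwa [h1, h1] at h2)
    exact ⟨⟨(i, ell Λ (D.P i ⧸ K)), h3, K, h1, h2, rfl, h4⟩⟩
  have hnext : ∀ x : St, ∃ y : St, D.τ^[y.1.2] y.1.1 = x.1.1 ∧ D.c y.1.1 = x.1.2 + y.1.2 := by
    rintro ⟨⟨i, k⟩, hb, K, hK0, hKt, hk, z, a, b, hab⟩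
    have hk' : k = ell Λ (D.P i ⧸ K) := hk
    have hU' := (D.U i).quot hKt
    have hnp : ¬ Module.Projective Λ (D.P i ⧸ K) := by
      intro hp
      have := hU'.nt
      have h1 := (D.U i).injective_of_split K.mkQ K.mkQ_surjective
      rw [← LinearMap.ker_eq_bot, Submodule.ker_mkQ] at h1
      exact hK0 h1
    obtain ⟨i', K', h1, h2, h3, h4, h5, h6⟩ := D.step hproj hex hext hU' hnp z a b hab
    refine ⟨⟨(i', ell Λ (D.P i' ⧸ K')), h3, K', h1, h2, rfl, h4⟩, ?_, ?_⟩
    · have := hU'.nt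
      exact D.top_unique hU' h5 (D.top_quot (D.U i) K.mkQ K.mkQ_surjective ⟨_, D.hπ i⟩)
    · change D.c i' = k + _
      rw [hk']
      exact h6
  choose nx hnx1 hnx2 using hnext
  let x0 : St := hstart.some
  let x : ℕ → St := fun m => nx^[m] x0
  have hx : ∀ m, x (m + 1) = nx (x m) := fun m => Function.iterate_succ_apply' nx m x0
  have hγ : ∀ m, D.τ^[D.c (x (m + 2)).1.1] (x (m + 2)).1.1 = (x m).1.1 := by
    intro m
    rw [hx (m + 1), hnx2, Function.iterate_add_apply, hnx1, hx m, hnx1]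
  let t : ℕ → Fin s := fun m => (x (2 * m)).1.1
  have ht : ∀ m, D.τ^[D.c (t (m + 1))] (t (m + 1)) = t m := fun m => hγ (2 * m)
  obtain ⟨a, b, hab, htab⟩ : ∃ a b, a < b ∧ t a = t b := by
    obtain ⟨a, b, hne, h⟩ := Finite.exists_ne_map_eq_of_infinite t
    rcases lt_or_gt_of_ne hne with hl | hl
    · exact ⟨a, b, hl, h⟩
    · exact ⟨b, a, hl, h.symm⟩
  obtain ⟨l, hl, hred⟩ := h (b - a) (fun l => D.F (t (b - l))) (by omega) (by
    intro l hl
    have h1 := D.gamma_bwd (t (b - l))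
    have h2 : b - l = (b - (l + 1)) + 1 := by omega
    have h3 : D.τ^[D.c (t (b - l))] (t (b - l)) = t (b - (l + 1)) := by
      rw [h2]; exact ht _
    rw [h3] at h1
    exact h1) (by
    have h1 : b - (b - a) = a := by omega
    have h2 : t (b - (b - a)) = t (b - 0) := by rw [h1, Nat.sub_zero]; exact htab
    have h3 : ∀ i j, i = j → Nonempty ((D.F i : Type u) ≃ₗ[Λ] (D.F j : Type u)) := by
      rintro i _ rfl
      exact ⟨LinearEquiv.refl _ _⟩
    exact h3 _ _ h2)
  exact (x (2 * (b - l))).2.1 ((D.red_iff (LinearEquiv.refl _ _)).mp hred)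

end Setup

end Aux5

section Aux6

variable {Λ}

theorem ell_zero {M : Type u} [AddCommGroup M] [Module Λ M] [Subsingleton M] : ell Λ M = 0 := by
  unfold ell
  rw [Module.length_eq_zero]
  rfl

theorem IsU.eq_of_ell [IsArtinianRing Λ] {M : Type u} [AddCommGroup M] [Module Λ M]
    (h : IsU Λ M) {K L : Submodule Λ M} (hl : ell Λ K = ell Λ L) : K = L := by
  have := h.fin
  have key : ∀ K L : Submodule Λ M, ell Λ K = ell Λ L → K ≤ L → K = L := by
    intro K L hl hKL
    by_contra hne
    have h1 : K.comap L.subtype ≠ ⊤ := by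
      intro ht
      apply hne
      apply le_antisymm hKL
      rwa [Submodule.comap_subtype_eq_top] at ht
    have h2 := ell_lt h1
    rw [ell_congr (Submodule.comapSubtypeEquivOfLe hKL)] at h2
    omega
  rcases h.us K L with h | h
  · exact key K L hl h
  · exact (key L K hl.symm h).symm

theorem exists_sub_ell [IsArtinianRing Λ] {M : Type u} [AddCommGroup M] [Module Λ M]
    [Module.Finite Λ M] (k : ℕ) (hk : k ≤ ell Λ M) :
    ∃ K : Submodule Λ M, ell Λ K + k = ell Λ M := by
  induction k with
  | zero => exact ⟨⊤, by rw [ell_congr (Submodule.topEquiv (R := Λ) (M := M))]; rfl⟩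
  | succ k ih =>
    obtain ⟨K, hK⟩ := ih (by omega)
    have hnt : Nontrivial K := by
      by_contra hcon
      rw [not_nontrivial_iff_subsingleton] at hcon
      have := ell_zero (Λ := Λ) (M := K)
      omega
    obtain ⟨A, hA, -⟩ :=
      (eq_top_or_exists_le_coatom (⊥ : Submodule Λ K)).resolve_left bot_ne_top
    refine ⟨A.map K.subtype, ?_⟩
    have h1 := ell_congr (Submodule.equivMapOfInjective _ K.subtype_injective A)
    have h2 := ell_add A
    have h3 : ell Λ (K ⧸ A) = 1 := ell_eq_one_iff.mpr (isSimpleModule_iff_isCoatom.mpr hA)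
    omega

namespace Setup

variable {s : ℕ} (D : Setup Λ s)

theorem exists_map [IsArtinianRing Λ] (i : Fin s) (k : ℕ) (hk : k < D.c i) :
    ∃ f : D.P (D.τ^[k] i) →ₗ[Λ] D.P i, ell Λ (LinearMap.range f) + k = D.c i := by
  have := (D.U i).fin
  obtain ⟨K, hK⟩ := exists_sub_ell (Λ := Λ) (M := D.P i) k hk.le
  have hK0 : K ≠ ⊥ := by
    rintro rfl
    rw [ell_zero] at hK
    unfold c at hk
    omega
  have ht := D.top_sub k (D.U i) ⟨_, D.hπ i⟩ K hK0 hK.symm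
  obtain ⟨q, hq⟩ := D.cover ((D.U i).sub hK0) ht
  refine ⟨K.subtype.comp q, ?_⟩
  rw [LinearMap.range_comp, LinearMap.range_eq_top.mpr hq, Submodule.map_subtype_top]
  exact hK

theorem c_lt [IsArtinianRing Λ] (i : Fin s) (k : ℕ) (hk0 : 0 < k) (hk : k < D.c i)
    (hb : ¬ Module.Projective Λ (LinearMap.ker (D.π i))) : D.c i - k < D.c (D.τ^[k] i) := by
  obtain ⟨f, hf⟩ := D.exists_map i k hk
  have := (D.U i).fin
  have := (D.U (D.τ^[k] i)).fin
  have h1 := ell_range_add_ker f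
  have h2 : ell Λ (D.P (D.τ^[k] i)) = D.c (D.τ^[k] i) := rfl
  by_contra hcon
  have h3 : ell Λ (LinearMap.ker f) = 0 := by omega
  have h4 : Subsingleton (LinearMap.ker f) := by
    by_contra h
    rw [not_subsingleton_iff_nontrivial] at h
    have := ell_pos (Λ := Λ) (M := LinearMap.ker f)
    omega
  have h5 : Function.Injective f :=
    LinearMap.ker_eq_bot.mp (Submodule.subsingleton_iff_eq_bot.mp h4)
  have hp := D.proj (D.τ^[k] i)
  have h6 : Module.Projective Λ (LinearMap.range f) :=
    Module.Projective.of_equiv (LinearEquiv.ofInjective f h5)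
  apply hb
  refine proj_up D (D.U i) (K := LinearMap.range f) ?_ ?_ h6
  · intro h
    rw [h, ell_zero] at hf
    omega
  · apply (D.U i).le_coatom (D.coatom i)
    intro h
    rw [h, ell_congr (Submodule.topEquiv (R := Λ) (M := D.P i))] at hf
    unfold c at hf
    omega

theorem extend_black [IsNakayama Λ] (i : Fin s)
    (hb : ¬ Module.Projective Λ (LinearMap.ker (D.π i))) (K : Submodule Λ (D.P i))
    (φ : K →ₗ[Λ] Λ) : ∃ ψ : D.P i →ₗ[Λ] Λ, ψ.comp K.subtype = φ := by
  apply extend_ring D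
  intro j φ
  rcases extend_or (D.U i) (D.U j) (D.proj j) K φ with h | ⟨L, hKL, hL, ⟨e⟩⟩
  · exact h
  · exfalso
    have := D.proj j
    have := (D.U j).nt
    apply hb
    refine proj_up D (D.U i) (K := L) ?_ ((D.U i).le_coatom (D.coatom i) hL)
      (Module.Projective.of_equiv e.symm)
    exact Submodule.nontrivial_iff_ne_bot.mp e.toEquiv.nontrivial

/-- A bi-infinite combinatorial sequence gives a nonprojective Gorenstein projective. -/
theorem not_cmfree_of_seq [IsNakayama Λ] (i : ℤ → Fin s) (k : ℤ → ℕ)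
    (hb : ∀ z, ¬ Module.Projective Λ (LinearMap.ker (D.π (i z))))
    (hk0 : ∀ z, 0 < k z) (hk : ∀ z, k z < D.c (i z))
    (hi : ∀ z, i (z + 1) = D.τ^[k z] (i z)) (hkk : ∀ z, k (z + 1) = D.c (i z) - k z) :
    ¬ IsCMFree Λ := by
  intro h
  have H : ∀ z, ∃ f : D.P (i (z + 1)) →ₗ[Λ] D.P (i z),
      ell Λ (LinearMap.range f) + k z = D.c (i z) := by
    intro z
    rw [hi z]
    exact D.exists_map _ _ (hk z)
  choose d hd using H
  have hfin : ∀ z, Module.Finite Λ (D.P (i z)) := fun z => (D.U (i z)).fin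
  have hc : ∀ z, ell Λ (D.P (i z)) = D.c (i z) := fun z => rfl
  have hker : ∀ z, LinearMap.ker (d z) = LinearMap.range (d (z + 1)) := by
    intro z
    apply (D.U (i (z + 1))).eq_of_ell
    have h1 := ell_range_add_ker (d z)
    have h2 := hd z
    have h3 := hd (z + 1)
    have h4 := hkk z
    have h5 := hk z
    have h6 := hc (z + 1)
    have h7 := hk (z + 1)
    omega
  have hnp : ¬ Module.Projective Λ (LinearMap.range (d 0)) := by
    intro hp
    have h2 := hd 0
    have h4 := hkk 0
    have h7 := hk (0 + 1)
    have h8 := hk0 (0 + 1)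
    have hnt : Nontrivial (LinearMap.range (d 0)) := by
      by_contra hcon
      rw [not_nontrivial_iff_subsingleton] at hcon
      have := ell_zero (Λ := Λ) (M := LinearMap.range (d 0))
      omega
    have hinj := (D.U (i (0 + 1))).injective_of_split (d 0).rangeRestrict
      (d 0).surjective_rangeRestrict
    have h9 := ell_congr (LinearEquiv.ofBijective (d 0).rangeRestrict
      ⟨hinj, (d 0).surjective_rangeRestrict⟩)
    have h6 := hc (0 + 1)
    omega
  apply hnp
  apply h
  · exact ⟨_, hasLength_of⟩
  · refine ⟨fun z => ModuleCat.of Λ (D.P (i z)), d, fun z => D.proj _, ?_, ?_,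
      ⟨LinearEquiv.refl _ _⟩⟩
    · intro z
      rw [LinearMap.exact_iff]
      exact hker z
    · intro z φ hφ
      let φ : D.P (i (z + 1)) →ₗ[Λ] Λ := φ
      have hle : LinearMap.ker (d z) ≤ LinearMap.ker φ := by
        rw [hker z]
        exact LinearMap.range_le_ker_iff.mpr hφ
      let φ' : LinearMap.range (d z) →ₗ[Λ] Λ :=
        ((LinearMap.ker (d z)).liftQ φ hle).comp (d z).quotKerEquivRange.symm.toLinearMap
      obtain ⟨ψ, hψ⟩ := D.extend_black (i z) (hb z) (LinearMap.range (d z)) φ'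
      refine ⟨ψ, ?_⟩
      apply LinearMap.ext
      intro x
      have h1 := LinearMap.congr_fun hψ ((d z).quotKerEquivRange ((LinearMap.ker (d z)).mkQ x))
      have h2 : φ' ((d z).quotKerEquivRange ((LinearMap.ker (d z)).mkQ x)) = φ x := by
        change ((LinearMap.ker (d z)).liftQ φ hle) ((d z).quotKerEquivRange.symm _) = _
        rw [LinearEquiv.symm_apply_apply]
        rfl
      rw [h2] at h1
      exact h1

theorem red_of_cmfree [IsNakayama Λ] {s : ℕ} (D : Setup Λ s) (hp : MinProjLengthGT Λ s)
    (h : IsCMFree Λ) : EveryCycleHasRed Λ := by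
  intro n C hn hγ ⟨e0⟩
  by_contra hcon
  push Not at hcon
  have hsim : ∀ m, m < n → IsSimpleModule Λ (C m) := fun m hm => (hγ m hm).1
  have h0s := hsim 0 hn
  have hT : ∀ m, ∃ i, m ≤ n → Nonempty ((C m : Type u) ≃ₗ[Λ] (D.F i : Type u)) := by
    intro m
    rcases lt_trichotomy m n with hm | hm | hm
    · obtain ⟨i, hi⟩ := D.surj (C m) (hsim m hm)
      exact ⟨i, fun _ => hi⟩
    · obtain ⟨i, hi⟩ := D.surj (C m) (by rw [hm]; exact IsSimpleModule.congr e0)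
      exact ⟨i, fun _ => hi⟩
    · obtain ⟨i, hi⟩ := D.surj (C 0) h0s
      exact ⟨i, fun hm' => absurd hm' (by omega)⟩
  choose t ht using hT
  have htγ : ∀ m < n, t (m + 1) = D.τ^[D.c (t m)] (t m) := by
    intro m hm
    obtain ⟨e1⟩ := ht m hm.le
    obtain ⟨e2⟩ := ht (m + 1) hm
    obtain ⟨e3⟩ := D.gamma_fwd (hγ m hm) e1
    exact D.inj _ _ ⟨e2.symm ≪≫ₗ e3⟩
  have htn : t n = t 0 := by
    obtain ⟨e1⟩ := ht n le_rfl
    obtain ⟨e2⟩ := ht 0 hn.le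
    exact D.inj _ _ ⟨e1.symm ≪≫ₗ e0 ≪≫ₗ e2⟩
  have hblack : ∀ m ≤ n, ¬ Module.Projective Λ (LinearMap.ker (D.π (t m))) := by
    intro m hm hpr
    obtain ⟨e⟩ := ht m hm
    exact hcon m hm ((D.red_iff e).mpr hpr)
  let X : Set (Fin s) := {i | ∃ m < n, t m = i}
  have hX : ∀ m ≤ n, t m ∈ X := by
    intro m hm
    rcases hm.lt_or_eq with h | h
    · exact ⟨m, h, rfl⟩
    · exact ⟨0, hn, by rw [h, htn]⟩
  have hXb : ∀ i ∈ X, ¬ Module.Projective Λ (LinearMap.ker (D.π i)) := by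
    rintro _ ⟨m, hm, rfl⟩
    exact hblack m hm.le
  have hXγ : ∀ i ∈ X, D.τ^[D.c i] i ∈ X := by
    rintro _ ⟨m, hm, rfl⟩
    rw [← htγ m hm]
    exact hX _ hm
  let g : X → X := fun i => ⟨_, hXγ i.1 i.2⟩
  have hgs : Function.Surjective g := by
    rintro ⟨_, m, hm, rfl⟩
    rcases Nat.eq_zero_or_pos m with h0 | h0
    · subst h0
      refine ⟨⟨t (n - 1), hX _ (by omega)⟩, Subtype.ext ?_⟩
      change D.τ^[D.c (t (n - 1))] (t (n - 1)) = t 0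
      rw [← htγ (n - 1) (by omega), ← htn]
      congr 1; omega
    · refine ⟨⟨t (m - 1), hX _ (by omega)⟩, Subtype.ext ?_⟩
      change D.τ^[D.c (t (m - 1))] (t (m - 1)) = t m
      rw [← htγ (m - 1) (by omega)]
      congr 1; omega
  have hgi : Function.Injective g := Finite.injective_iff_surjective.mpr hgs
  let Y := {x : Fin s × ℕ // x.1 ∈ X ∧ 0 < x.2 ∧ x.2 < D.c x.1 ∧ D.τ^[x.2] x.1 ∈ X}
  have hY : Finite Y := by
    apply Finite.of_injective
      (fun y : Y => (⟨y.1.1, ⟨y.1.2, y.2.2.2.1⟩⟩ : Σ i : Fin s, Fin (D.c i)))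
    rintro ⟨⟨i, k⟩, hx⟩ ⟨⟨i', k'⟩, hx'⟩ hh
    simp only [Sigma.mk.injEq] at hh
    obtain ⟨rfl, hh⟩ := hh
    simp only [heq_eq_eq, Fin.mk.injEq] at hh
    subst hh
    rfl
  let G : Y → Y := fun y => ⟨(D.τ^[y.1.2] y.1.1, D.c y.1.1 - y.1.2), y.2.2.2.2,
    Nat.sub_pos_of_lt y.2.2.2.1, D.c_lt _ _ y.2.2.1 y.2.2.2.1 (hXb _ y.2.1), by
      change D.τ^[D.c y.1.1 - y.1.2] (D.τ^[y.1.2] y.1.1) ∈ X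
      rw [← Function.iterate_add_apply, Nat.sub_add_cancel y.2.2.2.1.le]
      exact hXγ _ y.2.1⟩
  have hG : Function.Injective G := by
    rintro ⟨⟨i, k⟩, h1, h2, h3, h4⟩ ⟨⟨i', k'⟩, h1', h2', h3', h4'⟩ hh
    have ha : D.τ^[k] i = D.τ^[k'] i' := congrArg (fun y : Y => y.1.1) hh
    have hb : D.c i - k = D.c i' - k' := congrArg (fun y : Y => y.1.2) hh
    have h3a : k < D.c i := h3
    have h3b : k' < D.c i' := h3'
    have hgg : g ⟨i, h1⟩ = g ⟨i', h1'⟩ := by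
      apply Subtype.ext
      change D.τ^[D.c i] i = D.τ^[D.c i'] i'
      rw [← Nat.sub_add_cancel h3a.le, Function.iterate_add_apply, ha, hb,
        ← Function.iterate_add_apply, Nat.sub_add_cancel h3b.le]
    have hii : i = i' := congrArg Subtype.val (hgi hgg)
    subst hii
    have hkk : k = k' := by omega
    subst hkk
    rfl
  let σ : Equiv.Perm Y := Equiv.ofBijective G ⟨hG, Finite.surjective_of_injective hG⟩
  -- starting point
  have hper : ∀ m ≤ n, ∃ N, m ≤ N ∧ D.τ^[N] (t 0) = t m := by
    intro m
    induction m with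
    | zero => exact fun _ => ⟨0, le_rfl, rfl⟩
    | succ m ih =>
      intro hm
      obtain ⟨N, hN, hN'⟩ := ih (by omega)
      refine ⟨D.c (t m) + N, ?_, ?_⟩
      · have := D.c_ge_two (t m)
        omega
      · rw [Function.iterate_add_apply, hN', htγ m hm]
  obtain ⟨N, hN, hN'⟩ := hper n le_rfl
  rw [htn] at hN'
  have hpp : t 0 ∈ Function.periodicPts D.τ := ⟨N, by omega, hN'⟩
  have hk0 := Function.minimalPeriod_pos_of_mem_periodicPts hpp
  have hks : Function.minimalPeriod D.τ (t 0) ≤ s := by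
    simpa using Function.minimalPeriod_le_card (f := D.τ) (x := t 0)
  have hcs : s < D.c (t 0) := by
    have := (D.U (t 0)).fin
    exact hp _ (D.proj (t 0)) (D.U (t 0)).indec _ hasLength_of
  let y0 : Y := ⟨(t 0, Function.minimalPeriod D.τ (t 0)), hX 0 hn.le, hk0, by
    change Function.minimalPeriod D.τ (t 0) < D.c (t 0)
    omega, by
    change D.τ^[Function.minimalPeriod D.τ (t 0)] (t 0) ∈ X
    rw [Function.iterate_minimalPeriod]
    exact hX 0 hn.le⟩
  let y : ℤ → Y := fun z => (σ ^ z) y0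
  have hy : ∀ z, y (z + 1) = G (y z) := by
    intro z
    change (σ ^ (z + 1)) y0 = σ ((σ ^ z) y0)
    rw [add_comm, zpow_add, zpow_one]
    rfl
  refine D.not_cmfree_of_seq (fun z => (y z).1.1) (fun z => (y z).1.2) (fun z => hXb _ (y z).2.1)
    (fun z => (y z).2.2.1) (fun z => (y z).2.2.2.1) ?_ ?_ h
  · intro z
    change (y (z + 1)).1.1 = _
    rw [hy]
  · intro z
    change (y (z + 1)).1.2 = _
    rw [hy]

end Setup

end Aux6

/-- CM-freeness criterion: a Nakayama algebra without simple projectives with `p > s` is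
CM-free (every Gorenstein projective module is projective) if and only if every cycle in
the resolution quiver contains at least one red vertex. -/
theorem cm_free_iff_every_cycle_has_red [IsNakayama Λ] (h0 : NoSimpleProjectives Λ)
    (s : ℕ) (hs : SimpleCount Λ s) (hp : MinProjLengthGT Λ s) :
    IsCMFree Λ ↔ EveryCycleHasRed Λ := by
  obtain ⟨D⟩ := exists_setup h0 s hs
  exact ⟨D.red_of_cmfree hp, D.cmfree_of_red⟩
end

section
/- If Λ is a Nakayama algebra with p > s which is a Gorenstein algebra, then its Gorenstein dimension is at most 2s − 2. -/
universe u

variable (Λ : Type u) [Ring Λ]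

section Homological

open CategoryTheory CategoryTheory.Abelian

/-- Vanishing of `Ext^n(X, M)`. -/
def EZ (R : Type u) [Ring R] (X M : Type u) [AddCommGroup X] [Module R X] [AddCommGroup M]
    [Module R M] (n : ℕ) : Prop :=
  Subsingleton (Ext (ModuleCat.of R X) (ModuleCat.of R M) n)

variable {R : Type u} [Ring R]
variable {X₁ X₂ X₃ M : Type u} [AddCommGroup X₁] [Module R X₁] [AddCommGroup X₂] [Module R X₂]
  [AddCommGroup X₃] [Module R X₃] [AddCommGroup M] [Module R M]

theorem exists_ses (f : X₁ →ₗ[R] X₂) (g : X₂ →ₗ[R] X₃)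
    (hf : Function.Injective f) (hg : Function.Surjective g) (h : Function.Exact f g) :
    ∃ w, (ShortComplex.mk (ModuleCat.ofHom f) (ModuleCat.ofHom g) w).ShortExact := by
  have w : ModuleCat.ofHom f ≫ ModuleCat.ofHom g = 0 := by
    ext x
    exact h.apply_apply_eq_zero x
  exact ⟨w, ModuleCat.shortComplex_shortExact _ h hf hg⟩

theorem EZ_shift_contra (f : X₁ →ₗ[R] X₂) (g : X₂ →ₗ[R] X₃)
    (hf : Function.Injective f) (hg : Function.Surjective g) (h : Function.Exact f g)
    [Module.Projective R X₂] {n : ℕ} (hn : 1 ≤ n) :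
    EZ R X₁ M n ↔ EZ R X₃ M (n + 1) := by
  obtain ⟨w, S⟩ := exists_ses f g hf hg h
  have : Projective (ModuleCat.of R X₂) := inferInstance
  obtain ⟨k, rfl⟩ : ∃ k, n = k + 1 := ⟨n - 1, by omega⟩
  constructor
  · intro hs
    refine subsingleton_of_forall_eq 0 fun x => ?_
    obtain ⟨y, hy⟩ := Ext.contravariant_sequence_exact₃ S (ModuleCat.of R M) x
      (Ext.eq_zero_of_projective (P := ModuleCat.of R X₂) _) (n₀ := k + 1) (by omega)
    have : y = 0 := hs.elim _ _
    rw [← hy, this]; simp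
  · intro hs
    refine subsingleton_of_forall_eq 0 fun x => ?_
    obtain ⟨y, hy⟩ := Ext.contravariant_sequence_exact₁ S (ModuleCat.of R M) x
      (n₁ := k + 1 + 1) (by omega) (hs.elim _ _)
    have : y = 0 := Ext.eq_zero_of_projective (P := ModuleCat.of R X₂) _
    rw [← hy, this]; simp

theorem EZ_shift_cov {X : Type u} [AddCommGroup X] [Module R X]
    (f : X₁ →ₗ[R] X₂) (g : X₂ →ₗ[R] X₃)
    (hf : Function.Injective f) (hg : Function.Surjective g) (h : Function.Exact f g)
    (hI : Module.Injective R X₂) {n : ℕ} (hn : 1 ≤ n) :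
    EZ R X X₃ n ↔ EZ R X X₁ (n + 1) := by
  obtain ⟨w, S⟩ := exists_ses f g hf hg h
  have : Injective (ModuleCat.of R X₂) := Module.injective_object_of_injective_module R X₂
  obtain ⟨k, rfl⟩ : ∃ k, n = k + 1 := ⟨n - 1, by omega⟩
  constructor
  · intro hs
    refine subsingleton_of_forall_eq 0 fun x => ?_
    obtain ⟨y, hy⟩ := Ext.covariant_sequence_exact₁ (ModuleCat.of R X) S x
      (Ext.eq_zero_of_injective (I := ModuleCat.of R X₂) _) (n₀ := k + 1) (by omega)
    have : y = 0 := hs.elim _ _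
    rw [← hy, this]; simp
  · intro hs
    refine subsingleton_of_forall_eq 0 fun x => ?_
    obtain ⟨y, hy⟩ := Ext.covariant_sequence_exact₃ (ModuleCat.of R X) S x
      (n₁ := k + 1 + 1) (by omega) (hs.elim _ _)
    have : y = 0 := Ext.eq_zero_of_injective (I := ModuleCat.of R X₂) _
    rw [← hy, this]; simp

theorem EZ_extend (f : X₁ →ₗ[R] X₂) (g : X₂ →ₗ[R] X₃)
    (hf : Function.Injective f) (hg : Function.Surjective g) (h : Function.Exact f g)
    (h1 : EZ R X₃ M 1) (φ : X₁ →ₗ[R] M) : ∃ ψ : X₂ →ₗ[R] M, ψ ∘ₗ f = φ := by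
  obtain ⟨w, S⟩ := exists_ses f g hf hg h
  obtain ⟨y, hy⟩ := Ext.contravariant_sequence_exact₁ S (ModuleCat.of R M)
    (Ext.mk₀ (ModuleCat.ofHom φ)) (n₁ := 1) (by omega) (h1.elim _ _)
  obtain ⟨ψ, rfl⟩ := (Ext.mk₀_bijective (ModuleCat.of R X₂) (ModuleCat.of R M)).2 y
  dsimp at hy
  rw [Ext.mk₀_comp_mk₀] at hy
  have := (Ext.mk₀_bijective _ _).1 hy
  refine ⟨ψ.hom, ?_⟩
  exact congrArg ModuleCat.Hom.hom this

theorem EZ_of_injDimLE (M : Type u) [AddCommGroup M] [Module R M] (n : ℕ) (h : InjDimLE R M n)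
    (X : Type u) [AddCommGroup X] [Module R X] (m : ℕ) (hm : n < m) : EZ R X M m := by
  induction n generalizing M m with
  | zero =>
    obtain ⟨I, η, d, hI, hη, h0, hd, hs⟩ := h
    have : Subsingleton (I 1) := hs 1 (by omega)
    have hsur : Function.Surjective η := fun x => (h0 x).1 (Subsingleton.elim _ _)
    let E := LinearEquiv.ofBijective η ⟨hη, hsur⟩
    have := hI 0
    have : Module.Injective R M := Module.Baer.injective
      ((Module.Baer.congr E).2 (Module.Baer.of_injective (hI 0)))
    have : Injective (ModuleCat.of R M) := Module.injective_object_of_injective_module R M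
    obtain ⟨k, rfl⟩ : ∃ k, m = k + 1 := ⟨m - 1, by omega⟩
    exact Ext.subsingleton_of_injective _ _ _
  | succ n ih =>
    obtain ⟨I, η, d, hI, hη, h0, hd, hs⟩ := h
    obtain ⟨k, rfl⟩ : ∃ k, m = k + 1 := ⟨m - 1, by omega⟩
    have hex : Function.Exact η (d 0).rangeRestrict := by
      intro x
      rw [← h0 x]
      exact Subtype.ext_iff
    refine (EZ_shift_cov η (d 0).rangeRestrict hη (LinearMap.surjective_rangeRestrict _) hex (hI 0)
      (by omega)).1 ?_
    refine ih (LinearMap.range (d 0)) ?_ k (by omega)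
    refine ⟨fun i => I (i + 1), (LinearMap.range (d 0)).subtype, fun i => d (i + 1),
      fun i => hI _, Subtype.val_injective, ?_, fun i => hd _, fun i hi => hs _ (by omega)⟩
    intro x
    rw [hd 0 x]
    simp

theorem injDimLE_of_cosyzygy {M I C : Type u} [AddCommGroup M] [Module R M] [AddCommGroup I]
    [Module R I] [AddCommGroup C] [Module R C] (f : M →ₗ[R] I) (g : I →ₗ[R] C)
    (hf : Function.Injective f) (hg : Function.Surjective g) (h : Function.Exact f g)
    (hI : Module.Injective R I) (n : ℕ) (hC : InjDimLE R C n) : InjDimLE R M (n + 1) := by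
  obtain ⟨I', η, d, hI', hη, h0, hd, hs⟩ := hC
  refine ⟨fun i => match i with | 0 => ModuleCat.of R I | i + 1 => I' i, f,
    fun i => match i with | 0 => η ∘ₗ g | i + 1 => d i, ?_, hf, ?_, ?_, ?_⟩
  · rintro (_ | i)
    · exact hI
    · exact hI' i
  · intro x
    rw [← h x]
    change η (g x) = 0 ↔ _
    exact ⟨fun hx => hη (by simpa using hx), fun hx => by simp [hx]⟩
  · rintro (_ | i)
    · intro x
      change d 0 x = 0 ↔ x ∈ Set.range (η ∘ₗ g)
      rw [h0 x]
      constructor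
      · rintro ⟨y, rfl⟩
        obtain ⟨z, rfl⟩ := hg y
        exact ⟨z, rfl⟩
      · rintro ⟨y, rfl⟩
        exact ⟨g y, rfl⟩
    · exact hd i
  · rintro (_ | i) hi
    · omega
    · exact hs i (by omega)

theorem injDimLE_of_injective {M : Type u} [AddCommGroup M] [Module R M]
    (hM : Module.Injective R M) : InjDimLE R M 0 := by
  refine ⟨fun i => match i with | 0 => ModuleCat.of R M | _ + 1 => ModuleCat.of R PUnit,
    LinearMap.id, fun i => 0, ?_, fun x y h => h, ?_, ?_, ?_⟩
  · rintro (_ | i)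
    · exact hM
    · exact ⟨fun X Y _ _ _ _ f _ g => ⟨0, fun x => Subsingleton.elim _ _⟩⟩
  · intro x
    simp
  · rintro (_ | i) x
    · exact ⟨fun _ => ⟨0, rfl⟩, fun _ => rfl⟩
    · exact ⟨fun _ => ⟨0, rfl⟩, fun _ => rfl⟩
  · rintro (_ | i) hi
    · omega
    · exact inferInstanceAs (Subsingleton PUnit)

/-- If the modules with vanishing `Ext^1` include enough cyclic submodules, `M` is injective. -/
theorem injective_of_test {κ : Type} (L : κ → Ideal R) (M : Type u) [AddCommGroup M] [Module R M]
    (hL : ∀ (X : Type u) [AddCommGroup X] [Module R X], Nontrivial X →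
      ∃ (k : κ) (x : X), x ≠ 0 ∧ ∀ r : R, r • x = 0 ↔ r ∈ L k)
    (hE : ∀ k, EZ R (R ⧸ L k) M 1) : Module.Injective R M := by
  refine ⟨fun X Y _ _ _ _ f hf g => ?_⟩
  have : Fact (Function.Injective f) := ⟨hf⟩
  let Z := Module.Baer.extensionOfMax f g
  suffices htop : Z.domain = ⊤ by
    refine ⟨Z.toLinearPMap.toFun ∘ₗ LinearMap.codRestrict _ LinearMap.id (fun x => by simp [htop]), ?_⟩
    intro x
    exact (Z.is_extension x).symm
  by_contra hne
  have hnt : Nontrivial (Y ⧸ Z.domain) := Submodule.Quotient.nontrivial_iff.2 hne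
  obtain ⟨k, x, hx0, hx⟩ := hL (Y ⧸ Z.domain) hnt
  obtain ⟨y, rfl⟩ := Submodule.Quotient.mk_surjective _ x
  have hx' : ∀ r : R, r • y ∈ Z.domain ↔ r ∈ L k := by
    intro r
    rw [← hx r, ← Submodule.Quotient.mk_smul, Submodule.Quotient.mk_eq_zero]
  -- the idealized extension problem
  obtain ⟨ψ, hψ⟩ := EZ_extend (L k).subtype (L k).mkQ Subtype.val_injective
    (Submodule.mkQ_surjective _) (LinearMap.exact_subtype_mkQ _) (hE k)
    (Z.toLinearPMap.toFun ∘ₗ (LinearMap.codRestrict Z.domain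
      ((LinearMap.toSpanSingleton R Y y) ∘ₗ (L k).subtype)
      (fun r => by simpa using (hx' r).2 r.2)))
  have hψ' : ∀ (r : R) (hr : r • y ∈ Z.domain), r • ψ 1 = Z.toLinearPMap ⟨r • y, hr⟩ := by
    intro r hr
    have := LinearMap.congr_fun hψ ⟨r, (hx' r).1 hr⟩
    rw [← map_smul, smul_eq_mul, mul_one]
    exact this
  let q₁ : Y →ₗ.[R] M := LinearPMap.mkSpanSingleton' y (ψ 1) (fun r hr => by
    rw [RingHom.id_apply, hψ' r (by rw [hr]; exact zero_mem _)]
    have : (⟨r • y, by rw [hr]; exact zero_mem _⟩ : Z.domain) = 0 := Subtype.ext hr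
    rw [this, LinearPMap.map_zero])
  have hagree : ∀ (x : Z.domain) (z : q₁.domain), (x : Y) = z → Z.toLinearPMap x = q₁ z := by
    rintro ⟨x, hx1⟩ ⟨z, hz⟩ (rfl : x = z)
    obtain ⟨r, rfl⟩ := Submodule.mem_span_singleton.1 hz
    rw [LinearPMap.mkSpanSingleton'_apply, RingHom.id_apply, hψ' r hx1]
  let q : Y →ₗ.[R] M := Z.toLinearPMap.sup q₁ hagree
  have hZq : Z.toLinearPMap ≤ q := LinearPMap.left_le_sup _ _ _
  let Z' : Module.Baer.ExtensionOf f g :=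
    { q with
      le := Z.le.trans hZq.1
      is_extension := fun m => by
        rw [Z.is_extension m]
        exact hZq.2 rfl }
  have hZ' : Z' = Z := Module.Baer.extensionOfMax_is_max f g Z' hZq
  have hy : y ∈ Z'.domain := by
    change y ∈ Z.domain ⊔ Submodule.span R {y}
    exact Submodule.mem_sup_right (Submodule.mem_span_singleton_self y)
  rw [hZ'] at hy
  exact hx0 ((Submodule.Quotient.mk_eq_zero _).2 hy)

theorem injDimLE_of_test {κ : Type} (L : κ → Ideal R)
    (hL : ∀ (X : Type u) [AddCommGroup X] [Module R X], Nontrivial X →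
      ∃ (k : κ) (x : X), x ≠ 0 ∧ ∀ r : R, r • x = 0 ↔ r ∈ L k) (n : ℕ)
    (M : Type u) [AddCommGroup M] [Module R M]
    (hE : ∀ k, EZ R (R ⧸ L k) M (n + 1)) : InjDimLE R M n := by
  induction n generalizing M with
  | zero => exact injDimLE_of_injective (injective_of_test L M hL hE)
  | succ n ih =>
    let I := Injective.under (ModuleCat.of R M)
    let f : M →ₗ[R] I := (Injective.ι (ModuleCat.of R M)).hom
    have hf : Function.Injective f := (ModuleCat.mono_iff_injective _).1 inferInstance
    have hI0 : Injective (ModuleCat.of R I) :=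
      inferInstanceAs (Injective (Injective.under (ModuleCat.of R M)))
    have hI : Module.Injective R I := Module.injective_module_of_injective_object R I
    have hg := Submodule.mkQ_surjective (LinearMap.range f)
    have hex : Function.Exact f (LinearMap.range f).mkQ := LinearMap.exact_map_mkQ_range f
    refine injDimLE_of_cosyzygy f (LinearMap.range f).mkQ hf hg hex hI n (ih _ fun k => ?_)
    exact (EZ_shift_cov f _ hf hg hex hI (by omega)).2 (hE k)

end Homological
section Combinatorial

/-- Left-handed combinatorial data of a Nakayama ring. -/
structure LeftData (R : Type u) [Ring R] {ι : Type} (e a : ι → R) (σ : ι → ι) (w : ℕ → ι → R) :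
    Prop where
  idem : ∀ i, e i * e i = e i
  ne : ∀ i, e i ≠ 0
  la : ∀ i, e (σ i) * a i = a i
  ra : ∀ i, a i * e i = a i
  inj : Function.Injective σ
  loc : ∀ i j x, e j * x = x → x * e i = x → (∃ r, x = r * a i) ∨ ∃ y, y * x = e i
  w0 : ∀ i, w 0 i = e i
  ws : ∀ m i, w (m + 1) i = a (σ^[m] i) * w m i
  nil : ∀ i, ∃ m, w m i = 0
  full : (1 : R) ∈ AddSubgroup.closure {y : R | ∃ i u v, y = u * e i * v}

namespace LeftData

variable {R : Type u} [Ring R] {ι : Type} {e a : ι → R} {σ : ι → ι} {w : ℕ → ι → R}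

theorem w_re (D : LeftData R e a σ w) (m : ℕ) (i : ι) : w m i * e i = w m i := by
  induction m with
  | zero => rw [D.w0, D.idem]
  | succ m ih => rw [D.ws, mul_assoc, ih]

theorem w_le (D : LeftData R e a σ w) (m : ℕ) (i : ι) : e (σ^[m] i) * w m i = w m i := by
  cases m with
  | zero => simp [D.w0, D.idem]
  | succ m => rw [D.ws, Function.iterate_succ_apply', ← mul_assoc, D.la]

theorem w_add (D : LeftData R e a σ w) (m k : ℕ) (i : ι) : w (k + m) i = w k (σ^[m] i) * w m i := by
  induction k with
  | zero => rw [D.w0, zero_add, D.w_le]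
  | succ k ih => rw [show k + 1 + m = (k + m) + 1 by omega, D.ws, ih, D.ws, mul_assoc,
      ← Function.iterate_add_apply]

theorem w_zero_of_le (D : LeftData R e a σ w) {m n : ℕ} {i : ι} (h : m ≤ n) (hm : w m i = 0) : w n i = 0 := by
  obtain ⟨k, rfl⟩ := Nat.exists_eq_add_of_le' h
  rw [D.w_add, hm, mul_zero]

/-- membership in a submodule is detected by the idempotents -/
theorem detect (D : LeftData R e a σ w) {X : Type u} [AddCommGroup X] [Module R X] (N : Submodule R X) (x : X)
    (h : ∀ i v, (e i * v) • x ∈ N) : x ∈ N := by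
  have key : ∀ z ∈ AddSubgroup.closure {y : R | ∃ i u v, y = u * e i * v}, z • x ∈ N := by
    intro z hz
    induction hz using AddSubgroup.closure_induction with
    | mem y hy =>
      obtain ⟨i, u, v, rfl⟩ := hy
      rw [mul_assoc, mul_smul]
      exact N.smul_mem _ (h i v)
    | zero => simp
    | add y z _ _ hy hz => rw [add_smul]; exact N.add_mem hy hz
    | neg y _ hy => rw [neg_smul]; exact N.neg_mem hy
  simpa using key 1 D.full

theorem loc' (D : LeftData R e a σ w) (i : ι) (x : R) (hx : x * e i = x) : (∃ r, x = r * a i) ∨ ∃ y, y * x = e i := by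
  by_contra! hcon
  have : x ∈ Submodule.span R {a i} := by
    refine D.detect _ _ fun j v => ?_
    rw [smul_eq_mul]
    rcases D.loc i j (e j * v * x) (by rw [← mul_assoc, ← mul_assoc, D.idem])
      (by rw [mul_assoc, hx]) with ⟨r, hr⟩ | ⟨y, hy⟩
    · rw [hr]; exact Submodule.mem_span_singleton.2 ⟨r, rfl⟩
    · exact absurd (by rw [← hy, mul_assoc]) (hcon.2 (y * (e j * v)))
  obtain ⟨r, hr⟩ := Submodule.mem_span_singleton.1 this
  exact hcon.1 r hr.symm

/-- Every nonzero element of `R e_i` generates some `R w_{m,i}`. -/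
theorem classify (D : LeftData R e a σ w) (i : ι) (x : R) (hx : x * e i = x) (h0 : x ≠ 0) :
    ∃ m, (∃ r, x = r * w m i) ∧ ∃ y, y * x = w m i := by
  by_contra! hcon
  have key : ∀ m, ∃ r, x = r * w m i := by
    intro m
    induction m with
    | zero => exact ⟨x, by rw [D.w0, hx]⟩
    | succ m ih =>
      obtain ⟨r, hr⟩ := ih
      rcases D.loc' (σ^[m] i) (r * e (σ^[m] i)) (by rw [mul_assoc, D.idem]) with ⟨r', h'⟩ | ⟨y, hy⟩
      · refine ⟨r', ?_⟩
        rw [D.ws, ← mul_assoc, ← h', mul_assoc, D.w_le, hr]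
      · exfalso
        refine hcon m ⟨r, hr⟩ y ?_
        rw [hr, ← D.w_le, ← mul_assoc r, ← mul_assoc, hy]
  obtain ⟨m, hm⟩ := D.nil i
  obtain ⟨r, hr⟩ := key m
  exact h0 (by rw [hr, hm, mul_zero])

/-- The left ideal of elements `r` with `r e_i ∈ R w_{m,i}`. -/
def L (e : ι → R) (w : ℕ → ι → R) (i : ι) (m : ℕ) : Ideal R :=
  (Submodule.span R {w m i}).comap (LinearMap.toSpanSingleton R R (e i))

theorem mem_L (i : ι) (m : ℕ) (r : R) : r ∈ L e w i m ↔ ∃ t, r * e i = t * w m i := by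
  simp [L, Submodule.mem_span_singleton, eq_comm]

open Classical in
/-- the length of `R e_i` -/
noncomputable def c (D : LeftData R e a σ w) (i : ι) : ℕ := Nat.find (D.nil i)

theorem w_c (D : LeftData R e a σ w) (i : ι) : w (D.c i) i = 0 := by classical exact Nat.find_spec (D.nil i)

theorem c_le (D : LeftData R e a σ w) {i : ι} {m : ℕ} (h : w m i = 0) : D.c i ≤ m := by
  classical exact Nat.find_min' (D.nil i) h

theorem c_pos (D : LeftData R e a σ w) (i : ι) : 0 < D.c i := by
  rw [Nat.pos_iff_ne_zero]
  intro h
  have := D.w_c i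
  rw [h, D.w0] at this
  exact D.ne i this

theorem c_step (D : LeftData R e a σ w) (i : ι) : D.c i ≤ D.c (σ i) + 1 := by
  refine D.c_le ?_
  have := D.w_add 1 (D.c (σ i)) i
  rw [this, Function.iterate_one, D.w_c, zero_mul]

theorem ann (D : LeftData R e a σ w) (i : ι) (m : ℕ) (hm : m ≤ D.c i) (r : R) :
    r * w m i = 0 ↔ r ∈ L e w (σ^[m] i) (D.c i - m) := by
  rw [mem_L]
  constructor
  · intro h
    by_cases h0 : r * e (σ^[m] i) = 0
    · exact ⟨0, by rw [h0, zero_mul]⟩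
    · obtain ⟨k, ⟨t, ht⟩, y, hy⟩ := D.classify (σ^[m] i) (r * e (σ^[m] i))
        (by rw [mul_assoc, D.idem]) h0
      have hw : w (k + m) i = 0 := by
        rw [D.w_add, ← hy, mul_assoc, mul_assoc, D.w_le, h, mul_zero]
      have := D.c_le hw
      obtain ⟨l, rfl⟩ : ∃ l, k = l + (D.c i - m) := ⟨k - (D.c i - m), by omega⟩
      exact ⟨t * w l (σ^[D.c i - m] (σ^[m] i)), by rw [ht, D.w_add, mul_assoc]⟩
  · rintro ⟨t, ht⟩
    rw [← D.w_le, ← mul_assoc, ht, mul_assoc, ← D.w_add, Nat.sub_add_cancel hm, D.w_c, mul_zero]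

theorem EZ_step (D : LeftData R e a σ w) (i : ι) (m : ℕ) (hm : m ≤ D.c i) (M : Type u) [AddCommGroup M] [Module R M]
    (n : ℕ) (hn : 1 ≤ n) :
    EZ R (R ⧸ L e w (σ^[m] i) (D.c i - m)) M n ↔ EZ R (R ⧸ L e w i m) M (n + 1) := by
  -- the projective module
  let P : Submodule R R := LinearMap.range (LinearMap.toSpanSingleton R R (e i))
  have memP : ∀ x : R, x ∈ P ↔ x * e i = x := by
    intro x
    constructor
    · rintro ⟨r, rfl⟩
      simp [mul_assoc, D.idem]
    · intro h
      exact ⟨x, by simpa using h⟩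
  have hP : Module.Projective R P := by
    refine Module.Projective.of_split P.subtype (LinearMap.toSpanSingleton R R (e i)).rangeRestrict ?_
    ext x
    simpa using (memP x).1 x.2
  let f0 : R →ₗ[R] P := LinearMap.codRestrict P (LinearMap.toSpanSingleton R R (w m i))
    (fun r => (memP _).2 (by simp [mul_assoc, D.w_re]))
  have hf0 : ∀ r, ((f0 r : P) : R) = r * w m i := fun r => rfl
  let f : (R ⧸ L e w (σ^[m] i) (D.c i - m)) →ₗ[R] P := (L e w (σ^[m] i) (D.c i - m)).liftQ f0
    (fun r hr => by
      rw [LinearMap.mem_ker]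
      exact Subtype.ext ((D.ann i m hm r).2 hr))
  let g : P →ₗ[R] (R ⧸ L e w i m) := (L e w i m).mkQ ∘ₗ P.subtype
  have hf : Function.Injective f := by
    rw [← LinearMap.ker_eq_bot, eq_bot_iff]
    intro x hx
    obtain ⟨r, rfl⟩ := Submodule.mkQ_surjective _ x
    have h1 : f0 r = 0 := hx
    have h2 : r * w m i = 0 := congrArg Subtype.val h1
    rw [Submodule.mem_bot, Submodule.mkQ_apply, Submodule.Quotient.mk_eq_zero]
    exact (D.ann i m hm r).1 h2
  have hg : Function.Surjective g := by
    intro x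
    obtain ⟨r, rfl⟩ := Submodule.mkQ_surjective _ x
    refine ⟨⟨r * e i, (memP _).2 (by rw [mul_assoc, D.idem])⟩, ?_⟩
    change (L e w i m).mkQ (r * e i) = _
    rw [← sub_eq_zero, ← map_sub, Submodule.mkQ_apply, Submodule.Quotient.mk_eq_zero, mem_L]
    exact ⟨0, by rw [sub_mul, mul_assoc, D.idem, sub_self, zero_mul]⟩
  have hex : Function.Exact f g := by
    rintro ⟨x, hx⟩
    have h1 : g ⟨x, hx⟩ = 0 ↔ x ∈ L e w i m := Submodule.Quotient.mk_eq_zero _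
    rw [h1, mem_L, (memP x).1 hx]
    constructor
    · rintro ⟨t, rfl⟩
      exact ⟨Submodule.Quotient.mk t, rfl⟩
    · rintro ⟨y, hy⟩
      obtain ⟨r, rfl⟩ := Submodule.mkQ_surjective _ y
      exact ⟨r, (congrArg Subtype.val hy).symm⟩
  exact EZ_shift_contra f g hf hg hex hn

theorem test (D : LeftData R e a σ w) (X : Type u) [AddCommGroup X] [Module R X] (hX : Nontrivial X) :
    ∃ (i : ι) (x : X), x ≠ 0 ∧ ∀ r : R, r • x = 0 ↔ r ∈ L e w i 1 := by
  classical
  obtain ⟨x, hx⟩ := exists_ne (0 : X)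
  obtain ⟨i, v, hiv⟩ : ∃ i v, (e i * v) • x ≠ 0 := by
    by_contra! hcon
    exact hx (by simpa using D.detect ⊥ x (fun i v => by simpa using hcon i v))
  obtain ⟨y, hy, hiv⟩ : ∃ y : X, e i • y = y ∧ y ≠ 0 :=
    ⟨(e i * v) • x, by rw [← mul_smul, ← mul_assoc, D.idem], hiv⟩
  have hex : ∃ m, w m i • y = 0 := by
    obtain ⟨m, hm⟩ := D.nil i
    exact ⟨m, by rw [hm, zero_smul]⟩
  obtain ⟨m, hm⟩ : ∃ m, Nat.find hex = m + 1 := by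
    refine Nat.exists_eq_succ_of_ne_zero ?_
    intro h
    have := Nat.find_spec hex
    rw [h, D.w0, hy] at this
    exact hiv this
  have h1 : w (m + 1) i • y = 0 := by rw [← hm]; exact Nat.find_spec hex
  have h2 : w m i • y ≠ 0 := Nat.find_min hex (by omega)
  refine ⟨σ^[m] i, w m i • y, h2, fun r => ?_⟩
  have h3 : r • w m i • y = (r * e (σ^[m] i)) • w m i • y := by
    rw [← mul_smul, ← mul_smul, mul_assoc, D.w_le]
  have hw1 : w 1 (σ^[m] i) = a (σ^[m] i) := by
    rw [D.ws 0, D.w0]; exact D.ra _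
  rw [mem_L, hw1]
  have h4 : a (σ^[m] i) • w m i • y = 0 := by rw [← mul_smul, ← D.ws, h1]
  constructor
  · intro hr
    rcases D.loc' (σ^[m] i) (r * e (σ^[m] i)) (by rw [mul_assoc, D.idem]) with h | ⟨t, ht⟩
    · exact h
    · exfalso
      refine h2 ?_
      rw [← D.w_le, mul_smul, ← ht, mul_smul t, ← h3, hr, smul_zero]
  · rintro ⟨t, ht⟩
    rw [h3, ht, mul_smul, h4, smul_zero]

theorem iterate_shift (F : ℕ → ℕ) (A : ℕ) (h : ∀ x, F (x + A) = F x + A) (j x : ℕ) :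
    F (x + j * A) = F x + j * A := by
  induction j with
  | zero => simp
  | succ j ih => rw [Nat.succ_mul, ← add_assoc, h, ih, add_assoc]

theorem iterate_rot (F : ℕ → ℕ) (A a : ℕ) (h : ∀ x, F (x + A) = F x + A) (ha : F a = a + A)
    (n j : ℕ) : F^[n] (a + j * A) = a + (j + n) * A := by
  induction n with
  | zero => rfl
  | succ n ih => rw [Function.iterate_succ_apply', ih, iterate_shift F A h, ha]; ring

theorem rotation (F : ℕ → ℕ) (hF : Monotone F) (a b A B : ℕ) (hab : a ≤ b) (hA : 0 < A)
    (h1 : ∀ x, F (x + A) = F x + A) (h2 : ∀ x, F (x + B) = F x + B) (ha : F a = a + A)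
    (hb : F b = b + B) : A = B := by
  have ha' := iterate_rot F A a h1 ha
  have hb' := fun n => iterate_rot F B b h2 hb n 0
  simp only [zero_mul, add_zero, zero_add] at hb'
  apply le_antisymm
  · by_contra! hlt
    have h := hF.iterate (b + 1) hab
    rw [hb', show a = a + 0 * A by simp, ha'] at h
    nlinarith
  · by_contra! hlt
    have h := hF.iterate (a + b * A + 1) (show b ≤ a + b * A by nlinarith)
    rw [hb', ha'] at h
    have h5 := Nat.mul_le_mul_left (a + b * A + 1) (Nat.succ_le_of_lt hlt)
    rw [Nat.mul_succ] at h5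
    rw [add_mul b] at h
    omega

theorem periodic_of_card [Fintype ι] (γ : ι → ι) (i : ι) :
    ∃ k, 0 < k ∧ Function.IsPeriodicPt γ k (γ^[Fintype.card ι - 1] i) := by
  obtain ⟨p, q, hpq, h⟩ := Fintype.exists_ne_map_eq_of_card_lt
    (fun p : Fin (Fintype.card ι + 1) => γ^[(p : ℕ)] i) (by simp)
  wlog hlt : (p : ℕ) < q generalizing p q
  · exact this q p hpq.symm h.symm (by
      have : (p : ℕ) ≠ q := fun h => hpq (Fin.ext h)
      omega)
  refine ⟨q - p, by omega, ?_⟩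
  have hper : Function.IsPeriodicPt γ (q - p) (γ^[(p : ℕ)] i) := by
    unfold Function.IsPeriodicPt Function.IsFixedPt
    rw [← Function.iterate_add_apply, Nat.sub_add_cancel hlt.le]
    exact h.symm
  have hle : (p : ℕ) ≤ Fintype.card ι - 1 := by have := q.2; omega
  obtain ⟨t, ht⟩ := Nat.exists_eq_add_of_le' hle
  rw [ht, Function.iterate_add_apply]
  exact hper.apply_iterate t

theorem injDim_le (D : LeftData R e a σ w) [Fintype ι] (M : Type u) [AddCommGroup M] [Module R M]
    (hM : ∃ n, InjDimLE R M n) : InjDimLE R M (2 * Fintype.card ι - 2) := by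
  refine injDimLE_of_test (fun i => L e w i 1) D.test _ M fun i₀ => ?_
  have hs : 0 < Fintype.card ι := Fintype.card_pos_iff.2 ⟨i₀⟩
  let T : ℕ → ι := fun x => σ^[x] i₀
  let f : ℕ → ℕ := fun x => x + D.c (T x)
  let γ : ι → ι := fun i => σ^[D.c i] i
  have hT : ∀ x, T (f x) = γ (T x) := fun x => by
    simp only [T, f, γ]
    rw [← Function.iterate_add_apply, add_comm]
  have hTk : ∀ k x, T (f^[k] x) = γ^[k] (T x) := by
    intro k
    induction k with
    | zero => intro x; rfl
    | succ k ih => intro x; rw [Function.iterate_succ_apply, Function.iterate_succ_apply, ih, hT]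
  have hmono : Monotone f := by
    refine monotone_nat_of_le_succ fun x => ?_
    have := D.c_step (T x)
    have h2 : σ (T x) = T (x + 1) := (Function.iterate_succ_apply' σ x i₀).symm
    rw [h2] at this
    simp only [f]
    omega
  have hlt : ∀ x, x < f x := fun x => by
    have := D.c_pos (T x)
    simp only [f]
    omega
  have hltk : ∀ k, 0 < k → ∀ x, x < f^[k] x := by
    intro k hk
    induction k with
    | zero => omega
    | succ k ih =>
      intro x
      rw [Function.iterate_succ_apply']
      rcases Nat.eq_zero_or_pos k with rfl | hk'
      · exact hlt x
      · exact (ih hk' x).trans (hlt _)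
  let E : ℕ → ℕ → ℕ → Prop := fun n x y => EZ R (R ⧸ L e w (T x) (y - x)) M n
  have step : ∀ n x y, 1 ≤ n → x ≤ y → y ≤ f x → (E n y (f x) ↔ E (n + 1) x y) := by
    intro n x y hn hxy hyf
    have h := D.EZ_step (T x) (y - x) (by simp only [f] at hyf; omega) M n hn
    have h1 : σ^[y - x] (T x) = T y := by
      simp only [T]
      rw [← Function.iterate_add_apply, Nat.sub_add_cancel hxy]
    have h2 : D.c (T x) - (y - x) = f x - y := by simp only [f]; omega
    rw [h1, h2] at h
    exact h
  have iter : ∀ k n x y, 1 ≤ n → x ≤ y → y ≤ f x →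
      (E n (f^[k] x) (f^[k] y) ↔ E (n + 2 * k) x y) := by
    intro k
    induction k with
    | zero => intros; rfl
    | succ k ih =>
      intro n x y hn hxy hyf
      rw [Function.iterate_succ_apply, Function.iterate_succ_apply,
        ih n (f x) (f y) hn (hmono hxy) (hmono hyf),
        step _ y (f x) (by omega) hyf (hmono hxy), step _ x y (by omega) hxy hyf]
      rfl
  have hfin : (E (2 * Fintype.card ι - 2 + 1) 0 1) := by
    have h1 := iter (Fintype.card ι - 1) 1 0 1 le_rfl (by omega) (hlt 0)
    rw [show 1 + 2 * (Fintype.card ι - 1) = 2 * Fintype.card ι - 2 + 1 by omega] at h1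
    rw [← h1]
    have hab : f^[Fintype.card ι - 1] 0 ≤ f^[Fintype.card ι - 1] 1 := hmono.iterate _ (by omega)
    have hba : f^[Fintype.card ι - 1] 1 ≤ f (f^[Fintype.card ι - 1] 0) := by
      rw [← Function.iterate_succ_apply' f, Function.iterate_succ_apply]
      exact hmono.iterate _ (hlt 0)
    obtain ⟨k₁, hk₁, hp₁⟩ := periodic_of_card γ (T 0)
    obtain ⟨k₂, hk₂, hp₂⟩ := periodic_of_card γ (T 1)
    rw [← hTk] at hp₁ hp₂
    generalize f^[Fintype.card ι - 1] 0 = a at *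
    generalize f^[Fintype.card ι - 1] 1 = b at *
    have hk : 0 < k₁ * k₂ := Nat.mul_pos hk₁ hk₂
    have hpa : Function.IsPeriodicPt γ (k₁ * k₂) (T a) := hp₁.mul_const k₂
    have hpb : Function.IsPeriodicPt γ (k₁ * k₂) (T b) := hp₂.const_mul k₁
    generalize k₁ * k₂ = k at *
    have shift : ∀ x, γ^[k] (T x) = T x → ∃ A, 0 < A ∧ f^[k] x = x + A ∧
        (∀ y, T (y + A) = T y) ∧ ∀ y, f^[k] (y + A) = f^[k] y + A := by
      intro x hx
      have hl := hltk k hk x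
      obtain ⟨A, hA⟩ := Nat.exists_eq_add_of_lt hl
      have hTA : ∀ y, T (y + (A + 1)) = T y := by
        rw [← hTk, hA] at hx
        have hx' : σ^[x] (σ^[A + 1] i₀) = σ^[x] i₀ := by
          rw [← Function.iterate_add_apply]; exact hx
        have := D.inj.iterate x hx'
        intro y
        simp only [T]
        rw [Function.iterate_add_apply, this]
      have hfA : ∀ y, f (y + (A + 1)) = f y + (A + 1) := by
        intro y
        simp only [f]
        rw [hTA]
        omega
      refine ⟨A + 1, by omega, by omega, hTA, ?_⟩
      have : ∀ k y, f^[k] (y + (A + 1)) = f^[k] y + (A + 1) := by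
        intro k
        induction k with
        | zero => intro y; rfl
        | succ k ih =>
          intro y
          rw [Function.iterate_succ_apply, Function.iterate_succ_apply, hfA, ih]
      exact this k
    obtain ⟨A, hA0, hA, hTA, hfA⟩ := shift a hpa
    obtain ⟨B, hB0, hB, hTB, hfB⟩ := shift b hpb
    have hAB : A = B := rotation f^[k] (hmono.iterate k) a b A B hab hA0 hfA hfB hA hB
    subst hAB
    obtain ⟨N, hN⟩ := hM
    have h2 := iter (k * N) 1 a b le_rfl hab hba
    have h3 : E (1 + 2 * (k * N)) a b :=
      EZ_of_injDimLE M N hN _ _ (by nlinarith)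
    rw [← h2, Function.iterate_mul] at h3
    have h4 := iterate_rot f^[k] A a hfA hA N 0
    have h5 := iterate_rot f^[k] A b hfA hB N 0
    simp only [zero_mul, add_zero, zero_add] at h4 h5
    rw [h4, h5] at h3
    have h6 : T (a + N * A) = T a := by
      clear * - hTA
      induction N with
      | zero => simp
      | succ N ih => rw [Nat.succ_mul, ← add_assoc, hTA, ih]
    have h7 : b + N * A - (a + N * A) = b - a := by omega
    simp only [E] at h3 ⊢
    rw [h6, h7] at h3
    exact h3
  exact hfin

end LeftData

end Combinatorial

namespace NakPart

theorem hasLength_of_finite (R : Type u) [Ring R] [IsArtinianRing R] (M : Type u)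
    [AddCommGroup M] [Module R M] [Module.Finite R M] : ∃ n, HasLength R M n := by
  obtain ⟨f, f0, n, hn⟩ := exists_covBy_seq_of_wellFoundedLT_wellFoundedGT (Submodule R M)
  exact ⟨n, fun i => f i, f0.eq_bot, hn.1.eq_top, fun i => hn.2 i i.2⟩

theorem simple_equiv {R : Type u} [Ring R] {S T : Type u} [AddCommGroup S] [Module R S]
    [AddCommGroup T] [Module R T] [IsSimpleModule R S] [IsSimpleModule R T] {v : S} {w : T}
    (hv : v ≠ 0) (hw : w ≠ 0) (h : ∀ r : R, r • v = 0 → r • w = 0) : Nonempty (S ≃ₗ[R] T) := by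
  have hsurj := IsSimpleModule.toSpanSingleton_surjective R hv
  have hker : LinearMap.ker (LinearMap.toSpanSingleton R S v) ≤
      LinearMap.ker (LinearMap.toSpanSingleton R T w) := fun r hr => by
    simpa using h r (by simpa using hr)
  let E := LinearMap.quotKerEquivOfSurjective _ hsurj
  let φ : S →ₗ[R] T := (Submodule.liftQ _ (LinearMap.toSpanSingleton R T w) hker).comp
    E.symm.toLinearMap
  have hφ : φ v = w := by
    have : E.symm v = Submodule.Quotient.mk (1 : R) := by
      rw [LinearEquiv.symm_apply_eq]
      simp [E]
    simp only [φ, LinearMap.comp_apply, LinearEquiv.coe_coe, this]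
    simp
  have hne : φ ≠ 0 := by
    intro h0
    rw [h0] at hφ
    exact hw (by simpa using hφ.symm)
  exact ⟨LinearEquiv.ofBijective φ (LinearMap.bijective_of_ne_zero hne)⟩

/-- choice of a minimal idempotent not killing `S` together with uniseriality -/
theorem exists_idem (R : Type u) [Ring R] [hN : IsNakayama R] (S : Type u) [AddCommGroup S]
    [Module R S] [IsSimpleModule R S] :
    ∃ (e : R) (v : S), e * e = e ∧ v ≠ 0 ∧ e • v = v ∧
      ∀ x y : R, x * e = x → y * e = y → (∃ r, x = r * y) ∨ ∃ r, y = r * x := by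
  have := hN.artinian
  have := IsSimpleModule.nontrivial R S
  obtain ⟨v0, hv0⟩ := exists_ne (0 : S)
  obtain ⟨I, ⟨e, he, rfl, v, hv⟩, hmin⟩ := IsArtinian.set_has_minimal (R := R) (M := R)
    {I | ∃ e : R, e * e = e ∧ I = Submodule.span R {e} ∧ ∃ v : S, e • v ≠ 0}
    ⟨_, 1, by simp, rfl, v0, by simpa⟩
  have key : ∀ f f' : R, ∀ N N' : Submodule R R, Disjoint N N' → f ∈ N → f' ∈ N' →
      f + f' = e → f * e = f → f • v ≠ 0 → e ∈ N := by
    intro f f' N N' hd hf hf' hff hfe hfv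
    have h1 : f - f * f = f * f' := by
      rw [sub_eq_iff_eq_add, ← mul_add, add_comm f' f, hff, hfe]
    have h2 : f - f * f = 0 := by
      refine (Submodule.disjoint_def.mp hd) _ (N.sub_mem hf (N.smul_mem f hf)) ?_
      rw [h1]
      exact N'.smul_mem f hf'
    have h3 := hmin _ ⟨f, (sub_eq_zero.mp h2).symm, rfl, v, hfv⟩
    have h4 : Submodule.span R {f} ≤ Submodule.span R {e} := by
      rw [Submodule.span_singleton_le_iff_mem, Submodule.mem_span_singleton]
      exact ⟨f, hfe⟩
    have h5 : e ∈ Submodule.span R {f} := by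
      by_contra h6
      exact h3 (lt_of_le_of_ne h4 fun h => h6 (h ▸ Submodule.mem_span_singleton_self e))
    exact (Submodule.span_singleton_le_iff_mem f N).mpr hf h5
  have hne : e ≠ 0 := by
    rintro rfl
    simp at hv
  have huni : IsUniserialMod R (Submodule.span R {e}) := by
    have : Module.Finite R (Submodule.span R {e}) := inferInstance
    refine hN.serial _ (hasLength_of_finite R _) ⟨⟨0, ⟨e, Submodule.mem_span_singleton_self e⟩, ?_⟩, ?_⟩
    · intro h
      exact hne (congrArg Subtype.val h).symm
    · have main : ∀ N N' : Submodule R (Submodule.span R {e}), IsCompl N N' →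
        ∀ f ∈ N, ∀ f' ∈ N', (f : R) + f' = e → (f : R) • v ≠ 0 → N' = ⊥ := by
        intro N N' hc f hf f' hf' hff hfv
        have hd : Disjoint (N.map (Submodule.subtype _)) (N'.map (Submodule.subtype _)) :=
          (Submodule.disjoint_map (Submodule.subtype_injective _) hc.disjoint)
        have h1 := key f f' _ _ hd ⟨f, hf, rfl⟩ ⟨f', hf', rfl⟩ hff (by
          obtain ⟨r, hr⟩ := Submodule.mem_span_singleton.mp f.2
          rw [← hr, smul_eq_mul, mul_assoc, he]) hfv
        obtain ⟨g, hg, hge⟩ := h1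
        have h2 : N = ⊤ := by
          rw [eq_top_iff]
          rintro ⟨x, hx⟩ -
          obtain ⟨r, rfl⟩ := Submodule.mem_span_singleton.mp hx
          have h3 : (⟨r • e, hx⟩ : Submodule.span R {e}) = r • g :=
            Subtype.ext (congrArg (fun z => r • z) hge.symm)
          rw [h3]
          exact N.smul_mem r hg
        have := hc.disjoint
        rw [h2] at this
        exact top_disjoint.mp this
      intro N N' hc
      have : (⟨e, Submodule.mem_span_singleton_self e⟩ : Submodule.span R {e}) ∈ N ⊔ N' := by
        rw [hc.sup_eq_top]; trivial
      obtain ⟨f, hf, f', hf', hff⟩ := Submodule.mem_sup.mp this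
      have hff2 : (f : R) + f' = e := congrArg Subtype.val hff
      by_cases hfv : (f : R) • v = 0
      · left
        refine main N' N hc.symm f' hf' f hf (by rw [add_comm]; exact hff2) ?_
        intro h
        apply hv
        rw [← hff2, add_smul, hfv, h, add_zero]
      · right
        exact main N N' hc f hf f' hf' hff2 hfv
  refine ⟨e, e • v, he, hv, by rw [smul_smul, he], fun x y hx hy => ?_⟩
  have hx' : x ∈ Submodule.span R {e} := Submodule.mem_span_singleton.mpr ⟨x, hx⟩
  have hy' : y ∈ Submodule.span R {e} := Submodule.mem_span_singleton.mpr ⟨y, hy⟩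
  have gen : ∀ X Y : Submodule.span R {e}, Submodule.span R {X} ≤ Submodule.span R {Y} →
      ∃ r, (X : R) = r * Y := by
    intro X Y h
    rw [Submodule.span_singleton_le_iff_mem, Submodule.mem_span_singleton] at h
    obtain ⟨r, hr⟩ := h
    exact ⟨r, (congrArg Subtype.val hr).symm⟩
  let X : Submodule.span R {e} := ⟨x, hx'⟩
  let Y : Submodule.span R {e} := ⟨y, hy'⟩
  rcases huni (Submodule.span R {X}) (Submodule.span R {Y}) with h | h
  · exact Or.inl (gen X Y h)
  · exact Or.inr (gen Y X h)

structure NakData (R : Type u) [Ring R] {ι : Type} (J : Ideal R) (e a : ι → R) (σ : ι → ι) :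
    Prop where
  idem : ∀ i, e i * e i = e i
  eJ : ∀ i, e i ∉ J
  Jr : ∀ x y, x ∈ J → x * y ∈ J
  la : ∀ i, e (σ i) * a i = a i
  ra : ∀ i, a i * e i = a i
  ane : ∀ i, a i ≠ 0
  aJ : ∀ i, a i ∈ J
  gen : ∀ i x, x * e i = x → x ∈ J → ∃ r, x = r * a i
  inv : ∀ i x, x * e i = x → x ∉ J → ∃ y, y * x = e i
  eq : ∀ i j x, e j * x = x → x * e i = x → x ∉ J → i = j
  full : (1 : R) ∈ AddSubgroup.closure {y | ∃ i u v, y = u * e i * v}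

theorem exists_nakData (R : Type u) [Ring R] [hN : IsNakayama R] (h0 : NoSimpleProjectives R)
    (s : ℕ) (hs : SimpleCount R s) :
    ∃ (J : Ideal R) (e a : Fin s → R) (σ : Fin s → Fin s), NakData R J e a σ := by
  have := hN.artinian
  obtain ⟨F, hF, hF2, hF3⟩ := hs
  choose e v he hv hev huni using fun i => exists_idem R (F i)
  have smul_ex : ∀ i (x : F i), x ≠ 0 → ∀ y : F i, ∃ r : R, r • x = y := by
    intro i x hx y
    obtain ⟨r, hr⟩ := IsSimpleModule.toSpanSingleton_surjective R hx y
    exact ⟨r, by simpa using hr⟩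
  -- an element of `R e_i` acting nontrivially on some simple acts nontrivially on `v_i`
  have act : ∀ i x, x * e i = x → ∀ j (w : F j), x • w ≠ 0 → x • v i ≠ 0 := by
    intro i x hx j w hw hxv
    have hw' : x • (e i • w) ≠ 0 := by rwa [smul_smul, hx]
    obtain ⟨y, hy⟩ := smul_ex j _ hw' (e i • w)
    rcases huni i (y * x) (e i - y * x) (by rw [mul_assoc, hx])
      (by rw [sub_mul, mul_assoc, hx, he]) with ⟨r, hr⟩ | ⟨r, hr⟩
    · have h1 : (e i - y * x) • (e i • w) = 0 := by
        rw [sub_smul, mul_smul y, hy, smul_smul, he, sub_self]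
      have h2 : (y * x) • (e i • w) = 0 := by rw [hr, mul_smul, h1, smul_zero]
      rw [mul_smul, hy] at h2
      rw [h2, smul_zero] at hw'
      exact hw' rfl
    · have h1 := congrArg (fun z => z • v i) hr
      simp only [sub_smul, mul_smul, hxv, hev, smul_zero, sub_zero] at h1
      exact hv i h1
  have inv : ∀ i x, x * e i = x → x • v i ≠ 0 → ∃ y, y * x = e i := by
    intro i x hx hxv
    obtain ⟨y, hy⟩ := smul_ex i _ hxv (v i)
    rcases huni i (y * x) (e i - y * x) (by rw [mul_assoc, hx])
      (by rw [sub_mul, mul_assoc, hx, he]) with ⟨r, hr⟩ | ⟨r, hr⟩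
    · exfalso
      have h1 := congrArg (fun z => z • v i) hr
      simp only [sub_smul, mul_smul, hy, hev, sub_self, smul_zero] at h1
      exact hv i h1
    · exact ⟨r * y + y, by rw [add_mul, mul_assoc, ← hr]; abel⟩
  let J : Ideal R := ⨅ j, Module.annihilator R (F j)
  have memJ : ∀ x, x ∈ J ↔ ∀ j (w : F j), x • w = 0 := by
    intro x
    simp [J, Submodule.mem_iInf, Module.mem_annihilator]
  have notJ : ∀ i x, x * e i = x → x ∉ J → x • v i ≠ 0 := by
    intro i x hx h
    rw [memJ] at h
    push Not at h
    obtain ⟨j, w, hw⟩ := h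
    exact act i x hx j w hw
  have exa : ∀ i, ∃ (k : Fin s) (a : R), e k * a = a ∧ a * e i = a ∧ a ≠ 0 ∧ a ∈ J ∧
      ∀ x, x * e i = x → x ∈ J → ∃ r, x = r * a := by
    intro i
    let M : Submodule R R := Submodule.span R {e i} ⊓
      LinearMap.ker (LinearMap.toSpanSingleton R (F i) (v i))
    have memM : ∀ x, x ∈ M ↔ x * e i = x ∧ x • v i = 0 := by
      intro x
      simp only [M, Submodule.mem_inf, Submodule.mem_span_singleton, LinearMap.mem_ker,
        LinearMap.toSpanSingleton_apply, smul_eq_mul]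
      refine and_congr_left fun _ => ⟨?_, fun h => ⟨x, h⟩⟩
      rintro ⟨r, rfl⟩
      rw [mul_assoc, he]
    have hM0 : M ≠ ⊥ := by
      intro hM
      apply h0 (F i) (hF i)
      let φ := (LinearMap.toSpanSingleton R (F i) (v i)).domRestrict (Submodule.span R {e i})
      have hφ : Function.Bijective φ := by
        constructor
        · rw [injective_iff_map_eq_zero]
          rintro ⟨x, hx⟩ h
          have : x ∈ M := ⟨hx, h⟩
          rw [hM] at this
          exact Subtype.ext ((Submodule.mem_bot R).mp this)
        · intro y
          obtain ⟨r, hr⟩ := smul_ex i _ (hv i) y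
          refine ⟨⟨r * e i, Submodule.mem_span_singleton.mpr ⟨r, rfl⟩⟩, ?_⟩
          change (r * e i) • v i = y
          rw [mul_smul, hev, hr]
      refine Module.Projective.of_split
        ((Submodule.subtype _).comp (LinearEquiv.ofBijective φ hφ).symm.toLinearMap)
        (LinearMap.toSpanSingleton R (F i) (v i)) ?_
      ext y
      exact (LinearEquiv.ofBijective φ hφ).apply_symm_apply y
    have : Nontrivial M := Submodule.nontrivial_iff_ne_bot.mpr hM0
    obtain ⟨N, hN, -⟩ := (eq_top_or_exists_le_coatom (⊥ : Submodule R M)).resolve_left bot_ne_top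
    obtain ⟨k, ⟨ψ⟩⟩ := hF3 (M ⧸ N) (isSimpleModule_iff_isCoatom.mpr hN)
    let π : M →ₗ[R] F k := ψ.toLinearMap.comp N.mkQ
    obtain ⟨y, hy⟩ : ∃ y, π y = v k := by
      obtain ⟨y, hy⟩ := N.mkQ_surjective (ψ.symm (v k))
      exact ⟨y, by simp [π, hy]⟩
    have ha := (e k • y).2
    have hπa : π (e k • y) = v k := by rw [map_smul, hy, hev]
    have ha' := (memM _).mp ha
    have hea : e k * ((e k • y : M) : R) = (e k • y : M) := by
      change e k * (e k * (y : R)) = e k * (y : R)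
      rw [← mul_assoc, he]
    refine ⟨k, (e k • y : M), hea, ha'.1, ?_, ?_, ?_⟩
    · intro h
      have h2 : e k • y = 0 := Subtype.ext h
      rw [h2, map_zero] at hπa
      exact hv k hπa.symm
    · by_contra h
      exact notJ i _ ha'.1 h ha'.2
    · intro x hx hxJ
      have hxM : x ∈ M := (memM x).mpr ⟨hx, (memJ x).mp hxJ _ _⟩
      obtain ⟨t, ht⟩ := smul_ex k _ (hv k) (π ⟨x, hxM⟩)
      have h1 : π (⟨x, hxM⟩ - t • (e k • y)) = 0 := by
        rw [map_sub, map_smul, hπa, ht, sub_self]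
      have hz := (memM _).mp (⟨x, hxM⟩ - t • (e k • y) : M).2
      rcases huni i _ _ hz.1 ha'.1 with ⟨r, hr⟩ | ⟨r, hr⟩
      · refine ⟨r + t, ?_⟩
        rw [add_mul, ← hr]
        simp
      · exfalso
        have h2 : e k • y = r • (⟨x, hxM⟩ - t • (e k • y) : M) := Subtype.ext hr
        have h3 := congrArg π h2
        rw [hπa, map_smul, h1, smul_zero] at h3
        exact hv k h3
  choose σ a hla hra hane haJ hgen using exa
  refine ⟨J, e, a, σ, he, ?_, ?_, hla, hra, hane, haJ, hgen, ?_, ?_, ?_⟩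
  · intro i h
    exact hv i (by rw [← hev i, (memJ _).mp h])
  · intro x y h
    rw [memJ] at *
    intro j w
    rw [mul_smul, h]
  · intro i x hx h
    exact inv i x hx (notJ i x hx h)
  · intro i j x hx hx' h
    by_contra hij
    have h1 := notJ i x hx' h
    have h2 : e j • (x • v i) = x • v i := by rw [smul_smul, hx]
    have := hF i
    have := hF j
    obtain ⟨E⟩ := simple_equiv (R := R) (hv j) h1 (by
      intro r hr
      rw [← h2, smul_smul]
      by_contra h3
      apply act j (r * e j) (by rw [mul_assoc, he]) i _ h3
      rw [mul_smul, hev, hr])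
    exact (hF2 j i (Ne.symm hij)).false E
  · have h1 : Ideal.span {y : R | ∃ i v, y = e i * v} = ⊤ := by
      by_contra h
      obtain ⟨m, hm, hle⟩ := Ideal.exists_le_maximal _ h
      obtain ⟨i, ⟨ψ⟩⟩ := hF3 (R ⧸ m) (isSimpleModule_iff_isCoatom.mpr hm.out)
      obtain ⟨r, hr⟩ := m.mkQ_surjective (ψ.symm (v i))
      apply hv i
      rw [← hev i, ← ψ.apply_symm_apply (v i), ← hr, ← map_smul, ← map_smul]
      have : e i • r ∈ m := hle (Ideal.subset_span ⟨i, r, rfl⟩)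
      rw [Submodule.mkQ_apply, (Submodule.Quotient.mk_eq_zero m).mpr this, map_zero]
    have h2 : (1 : R) ∈ Ideal.span {y : R | ∃ i v, y = e i * v} := by rw [h1]; trivial
    refine Submodule.span_induction (p := fun x _ =>
      x ∈ AddSubgroup.closure {y | ∃ i u v, y = u * e i * v}) ?_ ?_ ?_ ?_ h2
    · rintro x ⟨i, v, rfl⟩
      exact AddSubgroup.subset_closure ⟨i, 1, v, by rw [one_mul]⟩
    · exact zero_mem _
    · intro x y _ _ hx hy
      exact add_mem hx hy
    · intro r x _ hx
      refine AddSubgroup.closure_induction (p := fun x _ =>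
        r * x ∈ AddSubgroup.closure {y | ∃ i u v, y = u * e i * v}) ?_ ?_ ?_ ?_ hx
      · rintro x ⟨i, u, v, rfl⟩
        exact AddSubgroup.subset_closure ⟨i, r * u, v, by simp only [mul_assoc]⟩
      · rw [mul_zero]; exact zero_mem _
      · intro x y _ _ hx hy
        rw [mul_add]; exact add_mem hx hy
      · intro x _ hx
        rw [mul_neg]; exact neg_mem hx

namespace NakData

variable {R : Type u} [Ring R] {ι : Type} {J : Ideal R} {e a : ι → R} {σ : ι → ι}

/-- the left ideal `J a_i` -/
def Ja (J : Ideal R) (a : ι → R) (i : ι) : Submodule R R :=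
  Submodule.map (LinearMap.toSpanSingleton R R (a i)) J

theorem mem_Ja {i : ι} {x : R} : x ∈ Ja J a i ↔ ∃ y ∈ J, x = y * a i := by
  simp [Ja, eq_comm]

theorem unit2 (D : NakData R J e a σ) (i : ι) (x : R) (h1 : e i * x = x) (h2 : x * e i = x)
    (hx : x ∉ J) : ∃ y, e i * y = y ∧ y * e i = y ∧ y * x = e i ∧ x * y = e i := by
  obtain ⟨y0, hy0⟩ := D.inv i x h2 hx
  have he := D.idem i
  have h3 : e i * y0 * e i * x = e i := by
    rw [mul_assoc (e i * y0), h1, mul_assoc, hy0, he]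
  have h4 : e i * y0 * e i * e i = e i * y0 * e i := by rw [mul_assoc, he]
  have h5 : e i * y0 * e i ∉ J := by
    intro h
    apply D.eJ i
    rw [← h3]
    exact D.Jr _ _ h
  obtain ⟨z, hz⟩ := D.inv i _ h4 h5
  refine ⟨e i * y0 * e i, by simp only [← mul_assoc, he], h4, h3, ?_⟩
  have h6 : x = z * e i := by
    rw [← h3, ← mul_assoc, hz, h1]
  calc x * (e i * y0 * e i) = z * (e i * e i * y0 * e i) := by
        rw [h6]; simp only [mul_assoc]
    _ = e i := by rw [he, hz]

theorem ann (D : NakData R J e a σ) (i : ι) (y : R) (h : y * a i = 0) : y * e (σ i) ∈ J := by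
  by_contra h1
  obtain ⟨z, hz⟩ := D.inv (σ i) (y * e (σ i)) (by rw [mul_assoc, D.idem]) h1
  apply D.ane i
  rw [← D.la i, ← hz, mul_assoc, mul_assoc y, D.la, h, mul_zero]

theorem diff (D : NakData R J e a σ) (i : ι) (x : R) (h : x * a i ∈ Ja J a i) :
    x * e (σ i) ∈ J := by
  obtain ⟨y, hy, hxy⟩ := mem_Ja.mp h
  have h1 := D.ann i (x - y) (by rw [sub_mul, hxy, sub_self])
  rw [sub_mul] at h1
  have h2 := J.add_mem h1 (D.Jr y (e (σ i)) hy)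
  simpa using h2

theorem a_notin (D : NakData R J e a σ) (i : ι) : a i ∉ Ja J a i := by
  intro h
  apply D.eJ (σ i)
  have := D.diff i 1 (by rwa [one_mul])
  rwa [one_mul] at this

theorem mulJ (D : NakData R J e a σ) (i : ι) (z x : R) (hz : z ∈ J) (hx : x ∈ J)
    (hxe : x * e i = x) : z * x ∈ Ja J a i := by
  obtain ⟨r, hr⟩ := D.gen i x hxe hx
  exact mem_Ja.mpr ⟨z * r, D.Jr _ _ hz, by rw [mul_assoc, ← hr]⟩

theorem Ja_mul (D : NakData R J e a σ) (i j : ι) (t y : R) (ht : t ∈ Ja J a i)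
    (hy : y * e j = y) : t * y ∈ Ja J a j := by
  obtain ⟨z, hz, rfl⟩ := mem_Ja.mp ht
  rw [mul_assoc]
  exact D.mulJ j z _ hz (D.Jr _ _ (D.aJ i)) (by rw [mul_assoc, hy])

/-- the amalgam relation -/
def K (J : Ideal R) (e a : ι → R) (u : R) (i j : ι) : Submodule R (R × R) where
  carrier := {x | ∃ μ, x.1 * e i - μ * u * a i ∈ Ja J a i ∧ x.2 * e j + μ * a j ∈ Ja J a j}
  zero_mem' := ⟨0, by simp, by simp⟩
  add_mem' := by
    rintro x y ⟨m, h1, h2⟩ ⟨n, h3, h4⟩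
    refine ⟨m + n, ?_, ?_⟩
    · have := (Ja J a i).add_mem h1 h3
      convert! this using 1
      simp only [Prod.fst_add, add_mul]
      abel
    · have := (Ja J a j).add_mem h2 h4
      convert! this using 1
      simp only [Prod.snd_add, add_mul]
      abel
  smul_mem' := by
    rintro r x ⟨m, h1, h2⟩
    refine ⟨r * m, ?_, ?_⟩
    · have := (Ja J a i).smul_mem r h1
      simpa only [Prod.smul_fst, smul_eq_mul, mul_sub, mul_assoc] using this
    · have := (Ja J a j).smul_mem r h2
      simpa only [Prod.smul_snd, smul_eq_mul, mul_add, mul_assoc] using this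

theorem mem_K {u : R} {i j : ι} {α β : R} : (α, β) ∈ K J e a u i j ↔
    ∃ μ, α * e i - μ * u * a i ∈ Ja J a i ∧ β * e j + μ * a j ∈ Ja J a j := Iff.rfl

theorem K_fst (D : NakData R J e a σ) {u : R} {i j : ι} {α β : R}
    (h : (α, β) ∈ K J e a u i j) : α * e i ∈ J := by
  obtain ⟨μ, h1, -⟩ := mem_K.mp h
  obtain ⟨y, hy, h2⟩ := mem_Ja.mp h1
  rw [sub_eq_iff_eq_add] at h2
  rw [h2]
  exact J.add_mem (J.mul_mem_left _ (D.aJ i)) (J.mul_mem_left _ (D.aJ i))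

theorem K_snd (D : NakData R J e a σ) {u : R} {i j : ι} {α β : R}
    (h : (α, β) ∈ K J e a u i j) : β * e j ∈ J := by
  obtain ⟨μ, -, h1⟩ := mem_K.mp h
  obtain ⟨y, hy, h2⟩ := mem_Ja.mp h1
  rw [← eq_sub_iff_add_eq] at h2
  rw [h2]
  exact J.sub_mem (J.mul_mem_left _ (D.aJ j)) (J.mul_mem_left _ (D.aJ j))

theorem amalgam (D : NakData R J e a σ) [hN : IsNakayama R] (i j : ι) (hk : σ i = σ j) (u : R)
    (hu1 : e (σ j) * u = u) (hu2 : u * e (σ j) = u) (hu : u ∉ J) :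
    i = j ∧ ∃ u', e i * u' = u' ∧ u' * e i = u' ∧ u * a i - a i * u' ∈ Ja J a i := by
  have := hN.artinian
  obtain ⟨v, hv1, hv2, hvu, huv⟩ := D.unit2 (σ j) u hu1 hu2 hu
  set k := σ j with hkdef
  have lai : e k * a i = a i := by rw [← hk]; exact D.la i
  have laj : e k * a j = a j := D.la j
  have diffi : ∀ x, x * a i ∈ Ja J a i → x * e k ∈ J := fun x h => by
    rw [← hk]; exact D.diff i x h
  have diffj : ∀ x, x * a j ∈ Ja J a j → x * e k ∈ J := fun x h => D.diff j x h
  let X := (R × R) ⧸ K J e a u i j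
  let P : R × R →ₗ[R] X := (K J e a u i j).mkQ
  have hP : ∀ x, P x = 0 ↔ x ∈ K J e a u i j := fun x =>
    Submodule.Quotient.mk_eq_zero _
  have hPs : ∀ x, ∃ y, P y = x := (K J e a u i j).mkQ_surjective
  let s : X := P (0, a j)
  have L1 : ∀ α β, α * e i ∈ J → β * e j ∈ J → ∃ r : R, P (α, β) = r • s := by
    intro α β hα hβ
    obtain ⟨r, hr⟩ := D.gen i _ (by rw [mul_assoc, D.idem]) hα
    obtain ⟨r', hr'⟩ := D.gen j _ (by rw [mul_assoc, D.idem]) hβ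
    refine ⟨r * v + r', ?_⟩
    rw [← sub_eq_zero, ← map_smul, ← map_sub, hP]
    refine mem_K.mpr ⟨r * v, ?_, ?_⟩
    · change (α - (r * v + r') • 0) * e i - _ ∈ _
      rw [smul_zero, sub_zero, hr, mul_assoc r, hvu, mul_assoc r, lai, sub_self]
      exact zero_mem _
    · have : (β - (r * v + r') • a j) * e j + r * v * a j = 0 := by
        rw [sub_mul, hr', smul_eq_mul, mul_assoc, D.ra, add_mul]
        abel
      change (β - (r * v + r') • a j) * e j + r * v * a j ∈ _
      rw [this]
      exact zero_mem _
  have JX : ∀ y ∈ J, ∀ x : X, ∃ r : R, y • x = r • s := by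
    intro y hy x
    obtain ⟨⟨α, β⟩, rfl⟩ := hPs x
    rw [← map_smul]
    exact L1 _ _ (D.Jr _ _ (D.Jr _ _ hy)) (D.Jr _ _ (D.Jr _ _ hy))
  have es : e k • s = s := by
    simp only [s]
    rw [← map_smul, Prod.smul_mk, smul_zero, smul_eq_mul, laj]
  have Js : ∀ y ∈ J, y • s = 0 := by
    intro y hy
    simp only [s]
    rw [← map_smul, Prod.smul_mk, smul_zero, hP]
    refine mem_K.mpr ⟨0, by simp, ?_⟩
    rw [zero_mul, add_zero, smul_eq_mul, mul_assoc, D.ra]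
    exact mem_Ja.mpr ⟨y, hy, rfl⟩
  have simp_s : ∀ r : R, r • s ≠ 0 → ∃ t : R, t • r • s = s := by
    intro r hr
    have h1 : r * e k ∉ J := by
      intro h
      apply hr
      rw [← es, smul_smul, Js _ h]
    obtain ⟨t, ht⟩ := D.inv k _ (by rw [mul_assoc, D.idem]) h1
    refine ⟨t, ?_⟩
    rw [← es, smul_smul r, smul_smul, ht]
  -- main part
  have main : ∀ N N' : Submodule R X, Disjoint N N' → s ∈ N → N' ≠ ⊥ →
      i = j ∧ ∃ u', e i * u' = u' ∧ u' * e i = u' ∧ u * a i - a i * u' ∈ Ja J a i := by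
    intro N N' hd hs hN'
    obtain ⟨n', hn', hn0⟩ := Submodule.exists_mem_ne_zero_of_ne_bot hN'
    have kill : ∀ y ∈ J, ∀ x ∈ N', y • x = 0 := by
      intro y hy x hx
      obtain ⟨r, hr⟩ := JX y hy x
      exact Submodule.disjoint_def.mp hd _ (hr ▸ N.smul_mem r hs) (N'.smul_mem y hx)
    obtain ⟨⟨α, β⟩, rfl⟩ := hPs n'
    have kill' : ∀ y ∈ J, ∀ t : R, (y * (t * α), y * (t * β)) ∈ K J e a u i j := by
      intro y hy t
      rw [← hP]
      exact kill y hy _ (N'.smul_mem t hn')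
    by_cases hα : α * e i ∈ J
    · by_cases hβ : β * e j ∈ J
      · exfalso
        obtain ⟨r, hr⟩ := L1 α β hα hβ
        exact hn0 (Submodule.disjoint_def.mp hd _ (hr ▸ N.smul_mem r hs) hn')
      · obtain ⟨t, ht⟩ := D.inv j _ (by rw [mul_assoc, D.idem]) hβ
        obtain ⟨μ, h1, h2⟩ := mem_K.mp (kill' _ (D.aJ j) t)
        have h3 : (1 + μ) * e k ∈ J := by
          apply diffj
          rw [mul_assoc, mul_assoc, ht, D.ra] at h2
          rwa [add_mul, one_mul]
        have h4 : a j * (e j * (t * α * e i)) + u * a i ∈ Ja J a i := by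
          have h5 : (1 + μ) * e k * u * a i ∈ Ja J a i := mem_Ja.mpr ⟨_, D.Jr _ _ h3, rfl⟩
          have h6 := (Ja J a i).add_mem h1 h5
          convert! h6 using 1
          rw [mul_assoc (1 + μ), hu1, add_mul, one_mul, add_mul, ← mul_assoc (a j), D.ra]
          simp only [mul_assoc]
          abel
        have hγ : e j * (t * α * e i) ∉ J := by
          intro h
          have h5 := D.mulJ i _ _ (D.aJ j) h (by simp only [mul_assoc, D.idem])
          have h6 := (Ja J a i).sub_mem h4 h5
          rw [add_sub_cancel_left] at h6
          have := diffi u h6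
          rw [hu2] at this
          exact hu this
        have hij := D.eq i j _ (by simp only [← mul_assoc, D.idem]) (by
          simp only [mul_assoc, D.idem]) hγ
        refine ⟨hij, - (e j * (t * α * e i)), ?_, ?_, ?_⟩
        · rw [hij, mul_neg]; simp only [← mul_assoc, D.idem]
        · rw [neg_mul]; simp only [mul_assoc, D.idem]
        · convert! h4 using 1
          rw [← hij]
          rw [mul_neg, sub_neg_eq_add, add_comm]
    · obtain ⟨t, ht⟩ := D.inv i _ (by rw [mul_assoc, D.idem]) hα
      obtain ⟨μ, h1, h2⟩ := mem_K.mp (kill' _ (D.aJ i) t)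
      have h3 : (1 - μ * u) * e k ∈ J := by
        apply diffi
        rw [mul_assoc, mul_assoc, ht, D.ra] at h1
        rwa [sub_mul, one_mul]
      have h7 : e k - u * μ * e k ∈ J := by
        have := D.Jr _ v (J.mul_mem_left u h3)
        convert! this using 1
        rw [sub_mul, one_mul, mul_sub, sub_mul, hu2, huv, mul_assoc μ, hu2]
        simp only [mul_assoc, huv]
      have h4 : u * (a i * (e i * (t * β * e j))) + a j ∈ Ja J a j := by
        have h5 : (e k - u * μ * e k) * a j ∈ Ja J a j := mem_Ja.mpr ⟨_, h7, rfl⟩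
        have h6 := (Ja J a j).add_mem ((Ja J a j).smul_mem u h2) h5
        convert! h6 using 1
        rw [sub_mul, laj, smul_eq_mul, mul_add, mul_assoc (u * μ), laj, ← mul_assoc (a i), D.ra]
        simp only [mul_assoc]
        abel
      have hγ : e i * (t * β * e j) ∉ J := by
        intro h
        have h5 := D.mulJ j _ _ (D.aJ i) h (by simp only [mul_assoc, D.idem])
        have h6 := (Ja J a j).sub_mem h4 ((Ja J a j).smul_mem u h5)
        rw [smul_eq_mul, add_sub_cancel_left] at h6
        exact D.a_notin j h6
      have hij := D.eq j i _ (by simp only [← mul_assoc, D.idem]) (by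
        simp only [mul_assoc, D.idem]) hγ
      refine ⟨hij.symm, ?_⟩
      clear_value k
      subst hij
      obtain ⟨δ, d1, d2, -, d3⟩ := D.unit2 j _ (by simp only [← mul_assoc, D.idem]) (by
        simp only [mul_assoc, D.idem]) hγ
      refine ⟨-δ, by rw [mul_neg, d1], by rw [neg_mul, d2], ?_⟩
      have h8 := D.Ja_mul j j _ δ h4 d2
      convert! h8 using 1
      rw [add_mul, mul_assoc, mul_assoc, d3, D.ra, mul_neg, sub_neg_eq_add]
  -- decomposability
  have hnon : ¬ IsUniserialMod R X := by
    intro h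
    rcases h (Submodule.span R {P (e i, 0)}) (Submodule.span R {P (0, e j)}) with h | h
    · rw [Submodule.span_singleton_le_iff_mem, Submodule.mem_span_singleton] at h
      obtain ⟨r, hr⟩ := h
      rw [eq_comm, ← sub_eq_zero, ← map_smul, ← map_sub, hP] at hr
      have : (e i - r • 0) * e i ∈ J := D.K_fst hr
      rw [smul_zero, sub_zero, D.idem] at this
      exact D.eJ i this
    · rw [Submodule.span_singleton_le_iff_mem, Submodule.mem_span_singleton] at h
      obtain ⟨r, hr⟩ := h
      rw [eq_comm, ← sub_eq_zero, ← map_smul, ← map_sub, hP] at hr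
      have : (e j - r • 0) * e j ∈ J := D.K_snd hr
      rw [smul_zero, sub_zero, D.idem] at this
      exact D.eJ j this
  have hnt : Nontrivial X := by
    refine ⟨0, P (e i, 0), fun h => ?_⟩
    have := D.K_fst ((hP _).mp h.symm)
    rw [D.idem] at this
    exact D.eJ i this
  have hdec : ¬ IsIndecomposableMod R X := fun h =>
    hnon (hN.serial X (hasLength_of_finite R X) h)
  obtain ⟨N, N', hc, hN0, hN0'⟩ : ∃ N N' : Submodule R X, IsCompl N N' ∧ N ≠ ⊥ ∧ N' ≠ ⊥ := by
    by_contra! h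
    refine hdec ⟨hnt, fun N N' hc => ?_⟩
    by_cases h1 : N = ⊥
    · exact Or.inl h1
    · exact Or.inr (h N N' hc h1)
  have hq : P (0, e j) ∈ N ⊔ N' := by rw [hc.sup_eq_top]; trivial
  obtain ⟨q1, hq1, q2, hq2, hq⟩ := Submodule.mem_sup.mp hq
  have hsq : s = a j • q1 + a j • q2 := by
    rw [← smul_add, hq, ← map_smul, Prod.smul_mk, smul_zero, smul_eq_mul, D.ra]
  obtain ⟨r, hr⟩ := JX _ (D.aJ j) q1
  by_cases h0 : a j • q1 = 0
  · rw [h0, zero_add] at hsq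
    exact main N' N hc.disjoint.symm (hsq ▸ N'.smul_mem _ hq2) hN0
  · rw [hr] at h0
    obtain ⟨t, ht⟩ := simp_s r h0
    refine main N N' hc.disjoint ?_ hN0'
    rw [← ht, ← hr]
    exact N.smul_mem _ (N.smul_mem _ hq1)

/-- path elements -/
def W (e a : ι → R) (σ : ι → ι) : ℕ → ι → R
  | 0, i => e i
  | m + 1, i => a (σ^[m] i) * W e a σ m i

theorem W_succ (e a : ι → R) (σ : ι → ι) (m : ℕ) (i : ι) :
    W e a σ (m + 1) i = a (σ^[m] i) * W e a σ m i := rfl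

theorem W_le (D : NakData R J e a σ) (m : ℕ) (i : ι) :
    e (σ^[m] i) * W e a σ m i = W e a σ m i := by
  cases m with
  | zero => exact D.idem i
  | succ m => rw [W_succ, ← mul_assoc, Function.iterate_succ_apply', D.la]

theorem W_one (D : NakData R J e a σ) (i : ι) : W e a σ 1 i = a i := D.ra i

theorem W_succ' (D : NakData R J e a σ) (m : ℕ) (i : ι) :
    W e a σ (m + 1) i = W e a σ m (σ i) * a i := by
  induction m with
  | zero => rw [D.W_one]; exact (D.la i).symm
  | succ m ih => rw [W_succ, ih, W_succ, Function.iterate_succ_apply, mul_assoc]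

theorem W_zero_of_le {m n : ℕ} {i : ι} (h : W e a σ m i = 0) (hmn : m ≤ n) :
    W e a σ n i = 0 := by
  induction n, hmn using Nat.le_induction with
  | base => exact h
  | succ n _ ih => rw [W_succ, ih, mul_zero]

theorem W_nil (D : NakData R J e a σ) [IsArtinianRing R] (i : ι) : ∃ m, W e a σ m i = 0 := by
  obtain ⟨I, ⟨m, rfl⟩, hmin⟩ := IsArtinian.set_has_minimal (R := R) (M := R)
    (Set.range fun m => Submodule.span R {W e a σ m i}) (Set.range_nonempty _)
  refine ⟨m, ?_⟩
  have h1 := hmin _ ⟨m + 1, rfl⟩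
  have h2 : Submodule.span R {W e a σ (m + 1) i} ≤ Submodule.span R {W e a σ m i} := by
    rw [Submodule.span_singleton_le_iff_mem, Submodule.mem_span_singleton]
    exact ⟨a (σ^[m] i), rfl⟩
  have h3 : W e a σ m i ∈ Submodule.span R {W e a σ (m + 1) i} := by
    by_contra h6
    exact h1 (lt_of_le_of_ne h2 fun h => h6 (by
      change Submodule.span R {W e a σ (m + 1) i} = Submodule.span R {W e a σ m i} at h
      rw [h]; exact Submodule.mem_span_singleton_self _))
  obtain ⟨r, hr⟩ := Submodule.mem_span_singleton.mp h3
  have hle := D.W_le m i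
  rw [W_succ, smul_eq_mul, ← mul_assoc] at hr
  set k := σ^[m] i
  have h4 : (e k - r * a k * e k) ∉ J := by
    intro h
    apply D.eJ k
    have := J.add_mem h (D.Jr _ (e k) (J.mul_mem_left r (D.aJ k)))
    simpa using this
  obtain ⟨t, ht⟩ := D.inv k _ (by rw [sub_mul, mul_assoc (r * a k), D.idem]) h4
  rw [← hle, ← ht, mul_assoc, sub_mul, mul_assoc (r * a k), hle, hr, sub_self, mul_zero]

theorem leftData (D : NakData R J e a σ) [IsArtinianRing R] (hσ : Function.Injective σ) :
    LeftData R e a σ (W e a σ) where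
  idem := D.idem
  ne := fun i h => D.eJ i (h ▸ J.zero_mem)
  la := D.la
  ra := D.ra
  inj := hσ
  loc := fun i j x _ hx => by
    by_cases h : x ∈ J
    · exact Or.inl (D.gen i x hx h)
    · exact Or.inr (D.inv i x hx h)
  w0 := fun _ => rfl
  ws := fun _ _ => rfl
  nil := D.W_nil
  full := D.full

theorem right_gen (D : NakData R J e a σ) [IsArtinianRing R] (hσ : Function.Injective σ)
    (hA : ∀ i u, e (σ i) * u = u → u * e (σ i) = u → ∃ u', u * a i - a i * u' ∈ Ja J a i)
    (k i : ι) (x : R) (h1 : e (σ k) * x = x) (h2 : x * e i = x) (hx : x ∈ J) :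
    ∃ r, x = a k * r := by
  obtain ⟨N, hN⟩ := D.W_nil i
  have main : ∀ n m, N ≤ (m + 1) + n → ∀ x, e (σ k) * x = x → (∃ r, x = r * W e a σ (m + 1) i) →
      ∃ r, x = a k * r := by
    intro n
    induction n with
    | zero =>
      rintro m hm x - ⟨r, rfl⟩
      exact ⟨0, by rw [W_zero_of_le hN hm, mul_zero, mul_zero]⟩
    | succ n ih =>
      rintro m hm x hx ⟨r0, hr0⟩
      obtain ⟨r, hre, hre', hr⟩ : ∃ r, e (σ k) * r = r ∧ r * e (σ^[m + 1] i) = r ∧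
          x = r * W e a σ (m + 1) i := by
        refine ⟨e (σ k) * r0 * e (σ^[m + 1] i), ?_, ?_, ?_⟩
        · simp only [← mul_assoc, D.idem]
        · simp only [mul_assoc, D.idem]
        · rw [mul_assoc, D.W_le, mul_assoc, ← hr0, hx]
      by_cases hrJ : r ∈ J
      · obtain ⟨t, ht⟩ := D.gen _ r hre' hrJ
        exact ih (m + 1) (by omega) x hx ⟨t, by rw [W_succ, ← mul_assoc, ← ht, hr]⟩
      · have hj := D.eq _ _ r hre hre' hrJ
        rw [Function.iterate_succ_apply'] at hj
        have hk := hσ hj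
        obtain ⟨u', hu'⟩ := hA k r hre (by rw [← hj, ← Function.iterate_succ_apply' σ]; exact hre')
        obtain ⟨y, hy, hyu⟩ := mem_Ja.mp hu'
        obtain ⟨t, ht⟩ := D.gen (σ k) (y * e (σ k)) (by rw [mul_assoc, D.idem]) (D.Jr _ _ hy)
        have h3 : r * a k = a k * u' + t * (a (σ k) * a k) := by
          rw [← mul_assoc, ← ht, mul_assoc, D.la, ← hyu]
          abel
        have h4 : x - a k * (u' * W e a σ m i) = t * W e a σ (m + 2) i := by
          rw [hr, W_succ e a σ (m + 1), W_succ, Function.iterate_succ_apply', hk, ← mul_assoc, h3,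
            add_mul]
          simp only [mul_assoc]
          abel
        obtain ⟨r2, hr2⟩ := ih (m + 1) (by omega) (x - a k * (u' * W e a σ m i)) (by
          rw [mul_sub, hx, ← mul_assoc, D.la]) ⟨t, h4⟩
        refine ⟨r2 + u' * W e a σ m i, ?_⟩
        rw [mul_add, ← hr2]
        abel
  obtain ⟨r, hr⟩ := D.gen i x h2 hx
  exact main N 0 (by omega) x h1 ⟨r, by rw [D.W_one]; exact hr⟩

open MulOpposite in
theorem rightData (D : NakData R J e a σ) [Fintype ι] [IsArtinianRing R]
    (hσ : Function.Injective σ)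
    (hA : ∀ i u, e (σ i) * u = u → u * e (σ i) = u → ∃ u', u * a i - a i * u' ∈ Ja J a i)
    (τ : ι → ι) (hτ : ∀ k, σ (τ k) = k) :
    LeftData Rᵐᵒᵖ (fun k => op (e k)) (fun k => op (a (τ k))) τ
      (W (fun k => op (e k)) (fun k => op (a (τ k))) τ) where
  idem := fun i => by rw [← op_mul, D.idem]
  ne := fun i h => D.eJ i ((op_eq_zero_iff _).mp h ▸ J.zero_mem)
  la := fun i => by rw [← op_mul, D.ra]
  ra := fun i => by
    rw [← op_mul]
    have := D.la (τ i)
    rw [hτ] at this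
    rw [this]
  inj := fun x y h => by rw [← hτ x, h, hτ]
  loc := fun i j x hx hx' => by
    have h1 : x.unop * e j = x.unop := congrArg unop hx
    have h2 : e i * x.unop = x.unop := congrArg unop hx'
    by_cases h : x.unop ∈ J
    · left
      obtain ⟨r, hr⟩ := D.right_gen hσ hA (τ i) j x.unop (by rw [hτ]; exact h2) h1 h
      exact ⟨op r, by rw [← op_mul, ← hr, op_unop]⟩
    · right
      have hij := D.eq _ _ _ h2 h1 h
      subst hij
      obtain ⟨y, -, -, -, hy⟩ := D.unit2 _ _ h2 h1 h
      exact ⟨op y, by rw [← hy, op_mul, op_unop]⟩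
  w0 := fun _ => rfl
  ws := fun _ _ => rfl
  nil := fun k => by
    choose N hN using D.W_nil
    have key : ∀ m, W (fun k => op (e k)) (fun k => op (a (τ k))) τ m k =
        op (W e a σ m (τ^[m] k)) := by
      intro m
      induction m with
      | zero => rfl
      | succ m ih => rw [W_succ, ih, D.W_succ', Function.iterate_succ_apply', hτ, op_mul]
    refine ⟨Finset.univ.sup N, ?_⟩
    rw [key, W_zero_of_le (hN _) (Finset.le_sup (Finset.mem_univ _)), op_zero]
  full := by
    rw [← op_one]
    refine AddSubgroup.closure_induction (p := fun x _ =>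
        op x ∈ AddSubgroup.closure {y | ∃ i u v, y = u * op (e i) * v}) ?_ ?_ ?_ ?_ D.full
    · rintro x ⟨i, u, v, rfl⟩
      exact AddSubgroup.subset_closure ⟨i, op v, op u, by simp only [op_mul, mul_assoc]⟩
    · exact zero_mem _
    · intro x y _ _ hx hy
      exact add_mem hx hy
    · intro x _ hx
      exact neg_mem hx

end NakData

end NakPart

/-- If `Λ` is a Nakayama algebra without simple projectives with `p > s` which is a
Gorenstein algebra, then its Gorenstein dimension (the injective dimension of `Λ` as a
left and as a right module over itself) is at most `2s - 2`. -/
theorem gorenstein_dimension_le [IsNakayama Λ] (h0 : NoSimpleProjectives Λ)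
    (s : ℕ) (hs : SimpleCount Λ s) (hp : MinProjLengthGT Λ s)
    (hG : IsGorensteinAlg Λ) :
    InjDimLE Λ Λ (2 * s - 2) ∧ InjDimLE Λᵐᵒᵖ Λ (2 * s - 2) := by
  have := ‹IsNakayama Λ›.artinian
  obtain ⟨J, e, a, σ, D⟩ := NakPart.exists_nakData Λ h0 s hs
  have hσ : Function.Injective σ := fun i j hij =>
    (D.amalgam i j hij (e (σ j)) (D.idem _) (D.idem _) (D.eJ _)).1
  have hA : ∀ i u, e (σ i) * u = u → u * e (σ i) = u →
      ∃ u', u * a i - a i * u' ∈ NakPart.NakData.Ja J a i := by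
    intro i u h1 h2
    by_cases hu : u ∈ J
    · exact ⟨0, by rw [mul_zero, sub_zero]; exact NakPart.NakData.mem_Ja.mpr ⟨u, hu, rfl⟩⟩
    · obtain ⟨-, u', -, -, h⟩ := D.amalgam i i rfl u h1 h2 hu
      exact ⟨u', h⟩
  have hsurj : Function.Surjective σ := Finite.surjective_of_injective hσ
  choose τ hτ using hsurj
  have hl := (D.leftData hσ).injDim_le Λ hG.1
  have hr := (D.rightData hσ hA τ hτ).injDim_le Λ hG.2
  rw [Fintype.card_fin] at hl hr
  exact ⟨hl, hr⟩
end
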